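/- Let b>0. Assume f satisfies (A1) and (A3) with exponent β, and g satisfies (A2) with exponent α, where either α=1, or α<1 and β < 1/(1−α). If u₀ satisfies (B1) or (B2), then there exists a viscosity solution u:(−b,b)×[0,∞)→ℝ of the initial value problem u_t − f(g(u_x)u_{xx}) = 0 in Q, with the singular Dirichlet condition lim_{x→±b}u(x,t)=∞ for every t>0, and initial datum u₀. -/

import Mathlib

open Filter Set Topology

noncomputable section

/-- The parabolic cylinder `Q = (-b,b) × (0,∞)`. -/
def Qset (b : ℝ) : Set (ℝ × ℝ) := Ioo (-b) b ×ˢ Ioi (0:ℝ)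

/-- The cylinder `Q₀ = (-b,b) × [0,∞)`. -/
def Q0set (b : ℝ) : Set (ℝ × ℝ) := Ioo (-b) b ×ˢ Ici (0:ℝ)

/-- Partial derivative in time. -/
def pT (φ : ℝ × ℝ → ℝ) (p : ℝ × ℝ) : ℝ := deriv (fun t => φ (p.1, t)) p.2

/-- Partial derivative in space. -/
def pX (φ : ℝ × ℝ → ℝ) (p : ℝ × ℝ) : ℝ := deriv (fun x => φ (x, p.2)) p.1

/-- Second partial derivative in space. -/
def pXX (φ : ℝ × ℝ → ℝ) (p : ℝ × ℝ) : ℝ := deriv (fun x => pX φ (x, p.2)) p.1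

/-- (A1): `f` is continuous, strictly increasing, `f 0 = 0`, `f(s) → ±∞` as `s → ±∞`. -/
def A1 (f : ℝ → ℝ) : Prop :=
  Continuous f ∧ StrictMono f ∧ f 0 = 0 ∧ Tendsto f atTop atTop ∧ Tendsto f atBot atBot

/-- (A2) with exponent `α`: `g` is continuous, positive, and `|s|^α g(s)` has positive
limits as `s → ±∞`. -/
def A2 (g : ℝ → ℝ) (α : ℝ) : Prop :=
  Continuous g ∧ (∀ s, 0 < g s) ∧
  ∃ Cgp Cgm : ℝ, 0 < Cgp ∧ 0 < Cgm ∧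
    Tendsto (fun s => |s| ^ α * g s) atTop (𝓝 Cgp) ∧
    Tendsto (fun s => |s| ^ α * g s) atBot (𝓝 Cgm)

/-- (A3) with exponent `β > 0`: `|s|^(-β) f s → ±C_{f±}` as `s → ±∞`. -/
def A3 (f : ℝ → ℝ) (β : ℝ) : Prop :=
  0 < β ∧ ∃ Cfp Cfm : ℝ, 0 < Cfp ∧ 0 < Cfm ∧
    Tendsto (fun s => |s| ^ (-β) * f s) atTop (𝓝 Cfp) ∧
    Tendsto (fun s => |s| ^ (-β) * f s) atBot (𝓝 (-Cfm))

/-- (B1): `u₀ ∈ C([-b,b])`. -/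
def B1 (b : ℝ) (u0 : ℝ → ℝ) : Prop := ContinuousOn u0 (Icc (-b) b)

/-- (B2): `u₀ ∈ C((-b,b))`, diverging to `∞` at `±b` with polynomial rate bound. -/
def B2 (b : ℝ) (u0 : ℝ → ℝ) : Prop :=
  ContinuousOn u0 (Ioo (-b) b) ∧
  Tendsto u0 (𝓝[<] b) atTop ∧ Tendsto u0 (𝓝[>] (-b)) atTop ∧
  ∃ γ : ℝ, 0 < γ ∧
    (∃ C : ℝ, ∀ᶠ x in 𝓝[<] b, u0 x * (b - x) ^ γ ≤ C) ∧
    (∃ C : ℝ, ∀ᶠ x in 𝓝[>] (-b), u0 x * (b + x) ^ γ ≤ C)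

/-- `ψ_γ(s) = s^(-γ)` for `γ > 0` and `ψ₀(s) = -log s`. -/
def psi (γ : ℝ) (s : ℝ) : ℝ := if 0 < γ then s ^ (-γ) else -Real.log s

/-- (B3): `u₀ ∈ C((-b,b))` behaves like `D₊ ψ_{γ₊}(b-x)` near `b` and like
`D₋ ψ_{γ₋}(b+x)` near `-b`, up to constants. -/
def B3 (b : ℝ) (u0 : ℝ → ℝ) (γp γm Dp Dm : ℝ) : Prop :=
  ContinuousOn u0 (Ioo (-b) b) ∧ 0 ≤ γp ∧ 0 ≤ γm ∧ 0 < Dp ∧ 0 < Dm ∧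
  ∃ Cp Cm : ℝ,
    Tendsto (fun x => u0 x - Dp * psi γp (b - x)) (𝓝[<] b) (𝓝 Cp) ∧
    Tendsto (fun x => u0 x - Dm * psi γm (b + x)) (𝓝[>] (-b)) (𝓝 Cm)

/-- Viscosity sub-solution of `u_t - f(g(u_x) u_{xx}) = 0` in `Q`. -/
def IsSubSol (b : ℝ) (f g : ℝ → ℝ) (u : ℝ × ℝ → ℝ) : Prop :=
  UpperSemicontinuousOn u (Q0set b) ∧
  ∀ φ : ℝ × ℝ → ℝ, ContDiffOn ℝ 2 φ (Qset b) →
    ∀ p ∈ Qset b, IsLocalMaxOn (fun q => u q - φ q) (Qset b) p →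
      pT φ p - f (g (pX φ p) * pXX φ p) ≤ 0

/-- The singular Dirichlet boundary condition at time `t`:
`v(x,t) → ∞` as `x → ±b`. -/
def SingularBC (b : ℝ) (v : ℝ × ℝ → ℝ) (t : ℝ) : Prop :=
  Tendsto (fun x => v (x, t)) (𝓝[<] b) atTop ∧
  Tendsto (fun x => v (x, t)) (𝓝[>] (-b)) atTop

/-- Viscosity super-solution of `u_t - f(g(u_x) u_{xx}) = 0` in `Q` together with the
singular Dirichlet boundary condition. -/
def IsSuperSol (b : ℝ) (f g : ℝ → ℝ) (v : ℝ × ℝ → ℝ) : Prop :=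
  LowerSemicontinuousOn v (Q0set b) ∧
  (∀ φ : ℝ × ℝ → ℝ, ContDiffOn ℝ 2 φ (Qset b) →
    ∀ p ∈ Qset b, IsLocalMinOn (fun q => v q - φ q) (Qset b) p →
      0 ≤ pT φ p - f (g (pX φ p) * pXX φ p)) ∧
  (∀ t : ℝ, 0 < t → SingularBC b v t)

/-- Upper semicontinuous envelope relative to `Q₀`. -/
def uscEnv (b : ℝ) (u : ℝ × ℝ → ℝ) (p : ℝ × ℝ) : ℝ := limsup u (𝓝[Q0set b] p)

/-- Lower semicontinuous envelope relative to `Q₀`. -/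
def lscEnv (b : ℝ) (u : ℝ × ℝ → ℝ) (p : ℝ × ℝ) : ℝ := liminf u (𝓝[Q0set b] p)

/-- Viscosity solution of the initial value problem: `u*` is a sub-solution, `u_*` is a
super-solution (including the singular Dirichlet condition), and both envelopes agree
with `u₀` at `t = 0`. -/
def IsVSol (b : ℝ) (f g : ℝ → ℝ) (u0 : ℝ → ℝ) (u : ℝ × ℝ → ℝ) : Prop :=
  IsSubSol b f g (uscEnv b u) ∧ IsSuperSol b f g (lscEnv b u) ∧
  ∀ x ∈ Ioo (-b) b, uscEnv b u (x, 0) = u0 x ∧ lscEnv b u (x, 0) = u0 x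

/-- The operator `u_t - f(g(u_x)u_xx)`. -/
def EOp (f g : ℝ → ℝ) (φ : ℝ × ℝ → ℝ) (p : ℝ × ℝ) : ℝ :=
  pT φ p - f (g (pX φ p) * pXX φ p)

/-- Pointwise viscosity sub-solution property. -/
def SubAt (b : ℝ) (f g : ℝ → ℝ) (w : ℝ × ℝ → ℝ) (p : ℝ × ℝ) : Prop :=
  ∀ φ : ℝ × ℝ → ℝ, ContDiffOn ℝ 2 φ (Qset b) →
    IsLocalMaxOn (fun q => w q - φ q) (Qset b) p → EOp f g φ p ≤ 0

theorem isOpen_Qset (b : ℝ) : IsOpen (Qset b) := isOpen_Ioo.prod isOpen_Ioi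

theorem Qset_sub_Q0 (b : ℝ) : Qset b ⊆ Q0set b :=
  Set.prod_mono subset_rfl Ioi_subset_Ici_self

theorem slice_x {φ : ℝ × ℝ → ℝ} {p : ℝ × ℝ} (h : DifferentiableAt ℝ φ p) :
    HasDerivAt (fun x => φ (x, p.2)) (fderiv ℝ φ p (1, 0)) p.1 := by
  have h1 : HasDerivAt (fun x : ℝ => (x, p.2)) ((1:ℝ), (0:ℝ)) p.1 :=
    (hasDerivAt_id p.1).prodMk (hasDerivAt_const p.1 p.2)
  exact HasFDerivAt.comp_hasDerivAt (f := fun x : ℝ => (x, p.2)) p.1 (by simpa using h.hasFDerivAt) h1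

theorem slice_t {φ : ℝ × ℝ → ℝ} {p : ℝ × ℝ} (h : DifferentiableAt ℝ φ p) :
    HasDerivAt (fun t => φ (p.1, t)) (fderiv ℝ φ p (0, 1)) p.2 := by
  have h1 : HasDerivAt (fun x : ℝ => (p.1, x)) ((0:ℝ), (1:ℝ)) p.2 :=
    (hasDerivAt_const p.2 p.1).prodMk (hasDerivAt_id p.2)
  exact HasFDerivAt.comp_hasDerivAt (f := fun x : ℝ => (p.1, x)) p.2 (by simpa using h.hasFDerivAt) h1

theorem diffAt_of_C2 {b : ℝ} {φ : ℝ × ℝ → ℝ} (h : ContDiffOn ℝ 2 φ (Qset b)) {p : ℝ × ℝ}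
    (hp : p ∈ Qset b) : DifferentiableAt ℝ φ p :=
  (h.contDiffAt ((isOpen_Qset b).mem_nhds hp)).differentiableAt (by norm_num)

theorem pX_eq {φ : ℝ × ℝ → ℝ} {p : ℝ × ℝ} (h : DifferentiableAt ℝ φ p) :
    pX φ p = fderiv ℝ φ p (1, 0) := (slice_x h).deriv

theorem pT_eq {φ : ℝ × ℝ → ℝ} {p : ℝ × ℝ} (h : DifferentiableAt ℝ φ p) :
    pT φ p = fderiv ℝ φ p (0, 1) := (slice_t h).deriv

theorem pX_C1 {b : ℝ} {φ : ℝ × ℝ → ℝ} (h : ContDiffOn ℝ 2 φ (Qset b)) :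
    ContDiffOn ℝ 1 (pX φ) (Qset b) := by
  have h1 : ContDiffOn ℝ 1 (fun p => fderiv ℝ φ p ((1:ℝ), (0:ℝ))) (Qset b) :=
    (h.fderiv_of_isOpen (m := 1) (isOpen_Qset b) (by norm_num)).clm_apply contDiffOn_const
  exact h1.congr fun p hp => pX_eq (diffAt_of_C2 h hp)

theorem pT_C1 {b : ℝ} {φ : ℝ × ℝ → ℝ} (h : ContDiffOn ℝ 2 φ (Qset b)) :
    ContDiffOn ℝ 1 (pT φ) (Qset b) := by
  have h1 : ContDiffOn ℝ 1 (fun p => fderiv ℝ φ p ((0:ℝ), (1:ℝ))) (Qset b) :=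
    (h.fderiv_of_isOpen (m := 1) (isOpen_Qset b) (by norm_num)).clm_apply contDiffOn_const
  exact h1.congr fun p hp => pT_eq (diffAt_of_C2 h hp)

theorem pX_diffAt {b : ℝ} {φ : ℝ × ℝ → ℝ} (h : ContDiffOn ℝ 2 φ (Qset b)) {p : ℝ × ℝ}
    (hp : p ∈ Qset b) : DifferentiableAt ℝ (pX φ) p :=
  ((pX_C1 h).contDiffAt ((isOpen_Qset b).mem_nhds hp)).differentiableAt (by norm_num)

theorem pXX_cont {b : ℝ} {φ : ℝ × ℝ → ℝ} (h : ContDiffOn ℝ 2 φ (Qset b)) :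
    ContinuousOn (pXX φ) (Qset b) := by
  have h1 : ContDiffOn ℝ 0 (fun p => fderiv ℝ (pX φ) p ((1:ℝ), (0:ℝ))) (Qset b) :=
    ((pX_C1 h).fderiv_of_isOpen (m := 0) (isOpen_Qset b) (by norm_num)).clm_apply contDiffOn_const
  exact h1.continuousOn.congr fun p hp => (slice_x (pX_diffAt h hp)).deriv

theorem EOp_cont {b : ℝ} {f g : ℝ → ℝ} (hf : Continuous f) (hg : Continuous g)
    {φ : ℝ × ℝ → ℝ} (h : ContDiffOn ℝ 2 φ (Qset b)) :
    ContinuousOn (EOp f g φ) (Qset b) := by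
  refine (pT_C1 h).continuousOn.sub (hf.comp_continuousOn ?_)
  exact (hg.comp_continuousOn (pX_C1 h).continuousOn).mul (pXX_cont h)

theorem nhds_slice_x {b : ℝ} {p : ℝ × ℝ} (hp : p ∈ Qset b) :
    ∀ᶠ x in 𝓝 p.1, (x, p.2) ∈ Qset b := by
  have : ContinuousAt (fun x : ℝ => (x, p.2)) p.1 := by fun_prop
  exact this.eventually ((isOpen_Qset b).mem_nhds hp)

theorem pX_add {φ ψ : ℝ × ℝ → ℝ} {p : ℝ × ℝ} (h : DifferentiableAt ℝ φ p)
    (h' : DifferentiableAt ℝ ψ p) : pX (fun q => φ q + ψ q) p = pX φ p + pX ψ p := by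
  rw [pX_eq h, pX_eq h']
  exact ((slice_x h).add (slice_x h')).deriv

theorem pT_add {φ ψ : ℝ × ℝ → ℝ} {p : ℝ × ℝ} (h : DifferentiableAt ℝ φ p)
    (h' : DifferentiableAt ℝ ψ p) : pT (fun q => φ q + ψ q) p = pT φ p + pT ψ p := by
  rw [pT_eq h, pT_eq h']
  exact ((slice_t h).add (slice_t h')).deriv

theorem pXX_add {b : ℝ} {φ ψ : ℝ × ℝ → ℝ} {p : ℝ × ℝ} (h : ContDiffOn ℝ 2 φ (Qset b))
    (h' : ContDiffOn ℝ 2 ψ (Qset b)) (hp : p ∈ Qset b) :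
    pXX (fun q => φ q + ψ q) p = pXX φ p + pXX ψ p := by
  have h1 : (fun x => pX (fun q => φ q + ψ q) (x, p.2)) =ᶠ[𝓝 p.1]
      fun x => pX φ (x, p.2) + pX ψ (x, p.2) := by
    filter_upwards [nhds_slice_x hp] with x hx
    exact pX_add (diffAt_of_C2 h hx) (diffAt_of_C2 h' hx)
  unfold pXX
  rw [h1.deriv_eq]
  exact deriv_fun_add (slice_x (pX_diffAt h hp)).differentiableAt
    (slice_x (pX_diffAt h' hp)).differentiableAt

theorem pXX_neg (φ : ℝ × ℝ → ℝ) (p : ℝ × ℝ) : pXX (fun q => - φ q) p = - pXX φ p := by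
  have h1 : ∀ q, pX (fun q => - φ q) q = - pX φ q := fun q => by
    unfold pX; exact deriv.fun_neg
  unfold pXX
  simp only [h1]
  exact deriv.fun_neg

theorem pX_neg (φ : ℝ × ℝ → ℝ) (p : ℝ × ℝ) : pX (fun q => - φ q) p = - pX φ p := deriv.fun_neg
theorem pT_neg (φ : ℝ × ℝ → ℝ) (p : ℝ × ℝ) : pT (fun q => - φ q) p = - pT φ p := deriv.fun_neg

/-- First and second order conditions at an interior maximum. -/
theorem max_cond {b : ℝ} {h : ℝ × ℝ → ℝ} {p : ℝ × ℝ} (hp : p ∈ Qset b)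
    (hh : ContDiffOn ℝ 2 h (Qset b)) (hm : IsLocalMaxOn h (Qset b) p) :
    pT h p = 0 ∧ pX h p = 0 ∧ pXX h p ≤ 0 := by
  have hm' : IsLocalMax h p := hm.isLocalMax ((isOpen_Qset b).mem_nhds hp)
  have ct : ContinuousAt (fun t : ℝ => (p.1, t)) p.2 := by fun_prop
  have cx : ContinuousAt (fun x : ℝ => (x, p.2)) p.1 := by fun_prop
  have mt : IsLocalMax (fun t => h (p.1, t)) p.2 := ct.eventually hm'
  have mx : IsLocalMax (fun x => h (x, p.2)) p.1 := cx.eventually hm'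
  refine ⟨mt.deriv_eq_zero, mx.deriv_eq_zero, ?_⟩
  by_contra hc
  push Not at hc
  have hdd : deriv (deriv (fun x => h (x, p.2))) p.1 = pXX h p := rfl
  have mn : IsLocalMin (fun x => h (x, p.2)) p.1 :=
    isLocalMin_of_deriv_deriv_pos (by rw [hdd]; exact hc) mx.deriv_eq_zero
      (slice_x (diffAt_of_C2 hh hp)).continuousAt
  have he : (fun x => h (x, p.2)) =ᶠ[𝓝 p.1] fun _ => h (p.1, p.2) := by
    filter_upwards [mx, mn] with x h1 h2
    exact le_antisymm h1 h2
  have : pXX h p = 0 := by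
    rw [← hdd, he.deriv.deriv_eq]; simp
  linarith

theorem SubAt.of_touch {b : ℝ} {f g : ℝ → ℝ} {w w' : ℝ × ℝ → ℝ} {p : ℝ × ℝ}
    (h : SubAt b f g w' p) (hle : ∀ᶠ q in 𝓝[Qset b] p, w' q ≤ w q) (he : w' p = w p) :
    SubAt b f g w p := by
  intro φ hφ hm
  refine h φ hφ ?_
  filter_upwards [hm, hle] with q h1 h2
  linarith

/-- Classical sub-solutions are viscosity sub-solutions. -/
theorem SubAt.classical {b : ℝ} {f g : ℝ → ℝ} (hf : StrictMono f) (hg : ∀ s, 0 < g s)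
    {ψ : ℝ × ℝ → ℝ} (hψ : ContDiffOn ℝ 2 ψ (Qset b)) {p : ℝ × ℝ} (hp : p ∈ Qset b)
    (h : EOp f g ψ p ≤ 0) : SubAt b f g ψ p := by
  intro φ hφ hm
  have hn : ContDiffOn ℝ 2 (fun q => - φ q) (Qset b) := hφ.neg
  have hd : ContDiffOn ℝ 2 (fun q => ψ q + - φ q) (Qset b) := hψ.add hn
  obtain ⟨h1, h2, h3⟩ := max_cond hp hd (by simpa [sub_eq_add_neg] using hm)
  rw [pT_add (diffAt_of_C2 hψ hp) (diffAt_of_C2 hn hp), pT_neg] at h1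
  rw [pX_add (diffAt_of_C2 hψ hp) (diffAt_of_C2 hn hp), pX_neg] at h2
  rw [pXX_add hψ hn hp, pXX_neg] at h3
  have e1 : pT φ p = pT ψ p := by linarith
  have e2 : pX φ p = pX ψ p := by linarith
  have e3 : f (g (pX ψ p) * pXX ψ p) ≤ f (g (pX ψ p) * pXX φ p) :=
    hf.monotone (mul_le_mul_of_nonneg_left (by linarith) (hg _).le)
  unfold EOp at *
  rw [e1, e2]
  linarith

theorem pX_pXX_of {φ : ℝ × ℝ → ℝ} {p : ℝ × ℝ} {D : ℝ → ℝ} {d2 : ℝ}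
    (h : ∀ᶠ x in 𝓝 p.1, HasDerivAt (fun x => φ (x, p.2)) (D x) x)
    (h2 : HasDerivAt D d2 p.1) : pX φ p = D p.1 ∧ pXX φ p = d2 := by
  refine ⟨h.self_of_nhds.deriv, ?_⟩
  have : (fun x => pX φ (x, p.2)) =ᶠ[𝓝 p.1] D := by
    filter_upwards [h] with x hx
    exact hx.deriv
  unfold pXX
  rw [this.deriv_eq]
  exact h2.deriv

/-- Quartic penalisation. -/
def quart (p q : ℝ × ℝ) : ℝ := (q.1 - p.1) ^ 4 + (q.2 - p.2) ^ 4

theorem quart_C2 (p : ℝ × ℝ) : ContDiff ℝ 2 (quart p) := by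
  unfold quart; fun_prop

theorem quart_der (p : ℝ × ℝ) : pT (quart p) p = 0 ∧ pX (quart p) p = 0 ∧ pXX (quart p) p = 0 := by
  have hx : ∀ x, HasDerivAt (fun x => quart p (x, p.2)) (4 * (x - p.1) ^ 3) x := by
    intro x
    have := (((hasDerivAt_id x).sub_const p.1).pow 4).add_const ((p.2 - p.2) ^ 4)
    simpa [quart] using this
  have ht : HasDerivAt (fun t => quart p (p.1, t)) 0 p.2 := by
    have := (((hasDerivAt_id p.2).sub_const p.2).pow 4).const_add ((p.1 - p.1) ^ 4)
    simpa [quart] using this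
  have hxx : HasDerivAt (fun x => 4 * (x - p.1) ^ 3) 0 p.1 := by
    have := (((hasDerivAt_id p.1).sub_const p.1).pow 3).const_mul 4
    simpa using this
  obtain ⟨h1, h2⟩ := pX_pXX_of (Eventually.of_forall hx) hxx
  exact ⟨ht.deriv, by simpa using h1, h2⟩

theorem EOp_add_quart {b : ℝ} {f g : ℝ → ℝ} {φ : ℝ × ℝ → ℝ} {p : ℝ × ℝ} (hp : p ∈ Qset b)
    (h : ContDiffOn ℝ 2 φ (Qset b)) :
    EOp f g (fun q => φ q + quart p q) p = EOp f g φ p := by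
  have hq : ContDiffOn ℝ 2 (quart p) (Qset b) := (quart_C2 p).contDiffOn
  obtain ⟨h1, h2, h3⟩ := quart_der p
  unfold EOp
  rw [pT_add (diffAt_of_C2 h hp) (diffAt_of_C2 hq hp), pX_add (diffAt_of_C2 h hp)
    (diffAt_of_C2 hq hp), pXX_add h hq hp, h1, h2, h3]
  simp

theorem EOp_sub_quart {b : ℝ} {f g : ℝ → ℝ} {φ : ℝ × ℝ → ℝ} {p : ℝ × ℝ} (hp : p ∈ Qset b)
    (h : ContDiffOn ℝ 2 φ (Qset b)) :
    EOp f g (fun q => φ q + - quart p q) p = EOp f g φ p := by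
  have hq : ContDiffOn ℝ 2 (fun q => - quart p q) (Qset b) := (quart_C2 p).contDiffOn.neg
  obtain ⟨h1, h2, h3⟩ := quart_der p
  unfold EOp
  rw [pT_add (diffAt_of_C2 h hp) (diffAt_of_C2 hq hp), pX_add (diffAt_of_C2 h hp)
    (diffAt_of_C2 hq hp), pXX_add h hq hp, pT_neg, pX_neg, pXX_neg, h1, h2, h3]
  simp

theorem EOp_add_const (f g : ℝ → ℝ) (φ : ℝ × ℝ → ℝ) (c : ℝ) (p : ℝ × ℝ) :
    EOp f g (fun q => φ q + c) p = EOp f g φ p := by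
  simp [EOp, pT, pX, pXX]

/-- Comparison of a viscosity sub-solution with a strict classical super-solution. -/
theorem comparison {b : ℝ} {f g : ℝ → ℝ} {w W : ℝ × ℝ → ℝ} {T : ℝ}
    (hwu : UpperSemicontinuousOn w (Q0set b)) (hw : ∀ p ∈ Qset b, SubAt b f g w p)
    (hWc : ContinuousOn W (Q0set b)) (hW : ContDiffOn ℝ 2 W (Qset b))
    (hWs : ∀ p ∈ Qset b, p.2 ≤ T → 0 < EOp f g W p)
    (h0 : ∀ x ∈ Ioo (-b) b, w (x, 0) ≤ W (x, 0))
    (hlat : ∃ ρ < b, ∀ x t, ρ ≤ |x| → |x| < b → 0 ≤ t → t < T → w (x, t) ≤ W (x, t)) :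
    ∀ p ∈ Q0set b, p.2 < T → w p ≤ W p := by
  obtain ⟨ρ, hρ, hlat⟩ := hlat
  rintro ⟨x0, t0⟩ ⟨hx0, ht0⟩ hT
  simp only [mem_Ici] at ht0 hx0 hT
  rcases ht0.eq_or_lt with rfl | ht0
  · exact h0 x0 hx0
  by_contra hc
  push Not at hc
  set η := (w (x0, t0) - W (x0, t0)) / 2 with hη
  have hηp : 0 < η := by rw [hη]; linarith
  have hx0' : |x0| < b := abs_lt.2 ⟨hx0.1, hx0.2⟩
  set r := max ρ |x0| with hr
  have hrb : r < b := max_lt hρ hx0'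
  set K : Set (ℝ × ℝ) := Icc (-r) r ×ˢ Icc 0 T with hK
  have hKc : IsCompact K := isCompact_Icc.prod isCompact_Icc
  have hKQ : K ⊆ Q0set b := by
    rintro ⟨x, t⟩ ⟨hx, ht⟩
    exact ⟨⟨by linarith [hx.1], by linarith [hx.2]⟩, ht.1⟩
  have hp0 : (x0, t0) ∈ K := by
    refine ⟨abs_le.1 (le_max_right _ _), ht0.le, hT.le⟩
  have usc1 : UpperSemicontinuousOn (fun q => w q + - W q) K :=
    (hwu.mono hKQ).add (hWc.mono hKQ).neg.upperSemicontinuousOn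
  obtain ⟨a, -, ha⟩ := usc1.exists_isMaxOn ⟨_, hp0⟩ hKc
  set N := w a + - W a with hN
  obtain ⟨m, hm⟩ := pow_unbounded_of_one_lt (N / η) ((one_lt_div ht0).2 hT)
  have hχ : ContDiff ℝ 2 (fun q : ℝ × ℝ => η * (q.2 / t0) ^ m) := by fun_prop
  have usc2 : UpperSemicontinuousOn (fun q => w q + - (W q + η * (q.2 / t0) ^ m)) K :=
    (hwu.mono hKQ).add ((hWc.mono hKQ).add hχ.continuous.continuousOn).neg.upperSemicontinuousOn
  obtain ⟨⟨x1, t1⟩, hp1, hmax⟩ := usc2.exists_isMaxOn ⟨_, hp0⟩ hKc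
  have hv : η ≤ w (x1, t1) + - (W (x1, t1) + η * (t1 / t0) ^ m) := by
    have := hmax hp0
    simp only [mem_ofPred_eq, div_self ht0.ne', one_pow, mul_one] at this
    linarith
  have ht1 : 0 ≤ t1 := hp1.2.1
  have hpw : 0 ≤ η * (t1 / t0) ^ m := by positivity
  have hx1b : |x1| ≤ r := abs_le.2 hp1.1
  have t1pos : 0 < t1 := by
    rcases ht1.eq_or_lt with h | h
    · subst h
      have := h0 x1 ⟨by linarith [hp1.1.1], by linarith [hp1.1.2]⟩
      linarith
    · exact h
  have t1T : t1 < T := by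
    rcases hp1.2.2.eq_or_lt with h | h
    · simp only at h
      have h2 := ha hp1
      simp only [mem_ofPred_eq] at h2
      rw [h] at hv h2
      rw [div_lt_iff₀ hηp] at hm
      linarith
    · exact h
  have hnl : ¬ ρ ≤ |x1| := by
    intro h
    have := hlat x1 t1 h (by linarith) ht1 t1T
    linarith
  have hx1r : |x1| < r := lt_of_lt_of_le (not_le.1 hnl) (le_max_left _ _)
  have hQ : (x1, t1) ∈ Qset b := ⟨⟨by linarith [hp1.1.1], by linarith [hp1.1.2]⟩, t1pos⟩
  have hKn : K ∈ 𝓝 (x1, t1) := by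
    apply prod_mem_nhds
    · exact Icc_mem_nhds (abs_lt.1 hx1r).1 (abs_lt.1 hx1r).2
    · exact Icc_mem_nhds t1pos t1T
  have hφ : ContDiffOn ℝ 2 (fun q => W q + η * (q.2 / t0) ^ m) (Qset b) := hW.add hχ.contDiffOn
  have key := hw _ hQ _ hφ (by
    apply IsLocalMax.on
    filter_upwards [hKn] with q hq
    have := hmax hq
    simp only [mem_ofPred_eq] at this
    linarith)
  have hpos := hWs _ hQ t1T.le
  have hχd := hχ.contDiffOn (s := Qset b)
  have c1 : 0 ≤ pT (fun q : ℝ × ℝ => η * (q.2 / t0) ^ m) (x1, t1) := by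
    have : HasDerivAt (fun t : ℝ => η * (t / t0) ^ m) (η * (m * (t1 / t0) ^ (m - 1) * (1 / t0))) t1 :=
      (((hasDerivAt_id t1).div_const t0).pow m).const_mul η
    have h2 : pT (fun q : ℝ × ℝ => η * (q.2 / t0) ^ m) (x1, t1) = _ := this.deriv
    rw [h2]; positivity
  have c2 : pX (fun q : ℝ × ℝ => η * (q.2 / t0) ^ m) (x1, t1) = 0 := by simp [pX]
  have c3 : pXX (fun q : ℝ × ℝ => η * (q.2 / t0) ^ m) (x1, t1) = 0 := by simp [pXX, pX]
  unfold EOp at key hpos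
  rw [pT_add (diffAt_of_C2 hW hQ) (diffAt_of_C2 hχd hQ), pX_add (diffAt_of_C2 hW hQ)
    (diffAt_of_C2 hχd hQ), pXX_add hW hχd hQ, c2, c3, add_zero, add_zero] at key
  linarith

theorem nb_Q0 {b : ℝ} {p : ℝ × ℝ} (hp : p ∈ Q0set b) : (𝓝[Q0set b] p).NeBot :=
  mem_closure_iff_nhdsWithin_neBot.1 (subset_closure hp)

/-- Local boundedness on `Q₀`. -/
def LB (b : ℝ) (u : ℝ × ℝ → ℝ) : Prop := ∀ p ∈ Q0set b,
  (∃ c, ∀ᶠ q in 𝓝[Q0set b] p, c ≤ u q) ∧ (∃ C, ∀ᶠ q in 𝓝[Q0set b] p, u q ≤ C)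

theorem usc_le {b : ℝ} {u : ℝ × ℝ → ℝ} (h : LB b u) {p : ℝ × ℝ} (hp : p ∈ Q0set b) {a : ℝ}
    (ha : ∀ᶠ q in 𝓝[Q0set b] p, u q ≤ a) : uscEnv b u p ≤ a := by
  have := nb_Q0 hp
  obtain ⟨c, hc⟩ := (h p hp).1
  have hb : IsBoundedUnder (· ≥ ·) (𝓝[Q0set b] p) u := ⟨c, by simpa using hc⟩
  exact limsup_le_of_le hb.isCoboundedUnder_le ha

theorem lt_of_usc {b : ℝ} {u : ℝ × ℝ → ℝ} (h : LB b u) {p : ℝ × ℝ} (hp : p ∈ Q0set b) {a : ℝ}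
    (ha : uscEnv b u p < a) : ∀ᶠ q in 𝓝[Q0set b] p, u q < a := by
  obtain ⟨c, hc⟩ := (h p hp).2
  have hb : IsBoundedUnder (· ≤ ·) (𝓝[Q0set b] p) u := ⟨c, by simpa using hc⟩
  exact eventually_lt_of_limsup_lt ha hb

theorem le_lsc {b : ℝ} {u : ℝ × ℝ → ℝ} (h : LB b u) {p : ℝ × ℝ} (hp : p ∈ Q0set b) {a : ℝ}
    (ha : ∀ᶠ q in 𝓝[Q0set b] p, a ≤ u q) : a ≤ lscEnv b u p := by
  have := nb_Q0 hp
  obtain ⟨c, hc⟩ := (h p hp).2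
  have hb : IsBoundedUnder (· ≤ ·) (𝓝[Q0set b] p) u := ⟨c, by simpa using hc⟩
  exact le_liminf_of_le hb.isCoboundedUnder_ge ha

theorem lt_of_lsc {b : ℝ} {u : ℝ × ℝ → ℝ} (h : LB b u) {p : ℝ × ℝ} (hp : p ∈ Q0set b) {a : ℝ}
    (ha : a < lscEnv b u p) : ∀ᶠ q in 𝓝[Q0set b] p, a < u q := by
  obtain ⟨c, hc⟩ := (h p hp).1
  have hb : IsBoundedUnder (· ≥ ·) (𝓝[Q0set b] p) u := ⟨c, by simpa using hc⟩
  exact eventually_lt_of_lt_liminf ha hb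

theorem le_usc {b : ℝ} {u : ℝ × ℝ → ℝ} (h : LB b u) {p : ℝ × ℝ} (hp : p ∈ Q0set b) :
    u p ≤ uscEnv b u p :=
  le_of_forall_gt fun _ ha => (lt_of_usc h hp ha).self_of_nhdsWithin hp

theorem lsc_le {b : ℝ} {u : ℝ × ℝ → ℝ} (h : LB b u) {p : ℝ × ℝ} (hp : p ∈ Q0set b) :
    lscEnv b u p ≤ u p :=
  le_of_forall_lt fun _ ha => (lt_of_lsc h hp ha).self_of_nhdsWithin hp

theorem usc_usc {b : ℝ} {u : ℝ × ℝ → ℝ} (h : LB b u) :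
    UpperSemicontinuousOn (uscEnv b u) (Q0set b) := by
  intro p hp y hy
  obtain ⟨y', h1, h2⟩ := exists_between hy
  have := eventually_eventually_nhdsWithin.2 (lt_of_usc h hp h1)
  filter_upwards [this, self_mem_nhdsWithin] with q hq hq0
  exact (usc_le h hq0 (hq.mono fun _ h => h.le)).trans_lt h2

theorem lsc_lsc {b : ℝ} {u : ℝ × ℝ → ℝ} (h : LB b u) :
    LowerSemicontinuousOn (lscEnv b u) (Q0set b) := by
  intro p hp y hy
  obtain ⟨y', h1, h2⟩ := exists_between hy
  have := eventually_eventually_nhdsWithin.2 (lt_of_lsc h hp h2)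
  filter_upwards [this, self_mem_nhdsWithin] with q hq hq0
  exact h1.trans_le (le_lsc h hq0 (hq.mono fun _ h => h.le))

theorem quart_ge {p q : ℝ × ℝ} {r : ℝ} (hr : 0 ≤ r) (h : r ≤ dist q p) : r ^ 4 ≤ quart p q := by
  rw [Prod.dist_eq, le_max_iff, Real.dist_eq, Real.dist_eq] at h
  unfold quart
  have e1 : (q.1 - p.1) ^ 4 = |q.1 - p.1| ^ 4 := by rw [← abs_pow, abs_of_nonneg (by positivity)]
  have e2 : (q.2 - p.2) ^ 4 = |q.2 - p.2| ^ 4 := by rw [← abs_pow, abs_of_nonneg (by positivity)]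
  rw [e1, e2]
  rcases h with h | h
  · have := pow_le_pow_left₀ hr h 4
    have h2 : 0 ≤ |q.2 - p.2| ^ 4 := by positivity
    linarith
  · have := pow_le_pow_left₀ hr h 4
    have h2 : 0 ≤ |q.1 - p.1| ^ 4 := by positivity
    linarith

theorem quart_self (p : ℝ × ℝ) : quart p p = 0 := by simp [quart]

theorem quart_nonneg (p q : ℝ × ℝ) : 0 ≤ quart p q := by unfold quart; positivity

/-- The upper envelope of a supremum of sub-solutions is a sub-solution. -/
theorem sup_stable {b : ℝ} {f g : ℝ → ℝ} (hf : Continuous f) (hg : Continuous g)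
    {S : Set (ℝ × ℝ → ℝ)} {u : ℝ × ℝ → ℝ} (hu : LB b u)
    (hSu : ∀ w ∈ S, UpperSemicontinuousOn w (Q0set b))
    (hSs : ∀ w ∈ S, ∀ p ∈ Qset b, SubAt b f g w p)
    (hle : ∀ w ∈ S, ∀ q ∈ Q0set b, w q ≤ u q)
    (hsup : ∀ q ∈ Q0set b, ∀ a < u q, ∃ w ∈ S, a < w q) :
    ∀ p ∈ Qset b, SubAt b f g (uscEnv b u) p := by
  intro p hp φ hφ hm
  by_contra hc
  push Not at hc
  have hp0 := Qset_sub_Q0 b hp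
  have hQn := (isOpen_Qset b).mem_nhds hp
  have hφ2 : ContDiffOn ℝ 2 (fun q => φ q + quart p q) (Qset b) := hφ.add (quart_C2 p).contDiffOn
  have hEc : ContinuousAt (EOp f g (fun q => φ q + quart p q)) p :=
    (EOp_cont hf hg hφ2).continuousAt hQn
  have hE : ∀ᶠ q in 𝓝 p, 0 < EOp f g (fun q => φ q + quart p q) q :=
    hEc.eventually_const_lt (by rw [EOp_add_quart hp hφ]; exact hc)
  have hm' := hm.isLocalMax hQn
  have hall : ∀ᶠ q in 𝓝 p, q ∈ Qset b ∧ 0 < EOp f g (fun q => φ q + quart p q) q ∧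
      uscEnv b u q - φ q ≤ uscEnv b u p - φ p := by
    filter_upwards [hQn, hE, hm'] with q h1 h2 h3 using ⟨h1, h2, h3⟩
  obtain ⟨r, hr, hB⟩ := Metric.nhds_basis_closedBall.eventually_iff.1 hall
  have hr4 : 0 < r ^ 4 := by positivity
  have hφc : ContinuousAt (fun q => φ q + quart p q) p := (diffAt_of_C2 hφ2 hp).continuousAt
  have hev : ∀ᶠ q in 𝓝[Q0set b] p, φ q + quart p q < φ p + r ^ 4 / 2 ∧ q ∈ Metric.closedBall p r := by
    apply Filter.Eventually.filter_mono nhdsWithin_le_nhds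
    exact (hφc.eventually_lt_const (by simp only [quart_self]; linarith)).and (Metric.closedBall_mem_nhds p hr)
  have hfr : ∃ᶠ q in 𝓝[Q0set b] p, uscEnv b u p - r ^ 4 / 2 < u q := by
    intro hcon
    have := usc_le hu hp0 (hcon.mono fun q hq => not_lt.1 hq)
    linarith
  obtain ⟨q0, hq0, hq1, hq2⟩ := (hfr.and_eventually hev).exists
  have hB0 : Metric.closedBall p r ⊆ Q0set b := fun q hq => Qset_sub_Q0 b (hB hq).1
  obtain ⟨w, hwS, hw⟩ := hsup q0 (hB0 hq2) _ hq0
  have husc : UpperSemicontinuousOn (fun q => w q + - (φ q + quart p q)) (Metric.closedBall p r) :=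
    ((hSu w hwS).mono hB0).add
      ((hφ2.continuousOn.mono fun q hq => (hB hq).1).neg.upperSemicontinuousOn)
  obtain ⟨a, ha, hmax⟩ := husc.exists_isMaxOn ⟨_, hq2⟩ (isCompact_closedBall p r)
  have h1 := hmax hq2
  simp only [mem_ofPred_eq] at h1
  have h2 := hle w hwS a (hB0 ha)
  have h3 := le_usc hu (hB0 ha)
  obtain ⟨haQ, haE, haM⟩ := hB ha
  have hda : dist a p < r := by
    by_contra hcon
    have := quart_ge hr.le (not_lt.1 hcon)
    linarith
  have := hSs w hwS a haQ _ hφ2 (by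
    apply IsLocalMax.on
    filter_upwards [Metric.closedBall_mem_nhds_of_mem (Metric.mem_ball.2 hda)] with q hq
    have := hmax hq
    simp only [mem_ofPred_eq] at this
    linarith)
  linarith

/-- The class of admissible sub-solutions. -/
def Cls {ι : Type*} (b : ℝ) (f g u0 : ℝ → ℝ) (W : ι → ℝ × ℝ → ℝ) (T : ι → ℝ)
    (w : ℝ × ℝ → ℝ) : Prop :=
  UpperSemicontinuousOn w (Q0set b) ∧ (∀ p ∈ Qset b, SubAt b f g w p) ∧
  (∀ x ∈ Ioo (-b) b, w (x, 0) ≤ u0 x) ∧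
  ∀ i, ∃ ρ < b, ∀ x t, ρ ≤ |x| → |x| < b → 0 ≤ t → t < T i → w (x, t) ≤ W i (x, t)

/-- The bump argument. -/
theorem bump {ι : Type*} {b : ℝ} {f g u0 : ℝ → ℝ} (hf : Continuous f) (hg : Continuous g)
    (hfm : StrictMono f) (hgp : ∀ s, 0 < g s)
    {W : ι → ℝ × ℝ → ℝ} {T : ι → ℝ} {u : ℝ × ℝ → ℝ} (hu : LB b u)
    (hC : Cls b f g u0 W T u)
    (hmaxl : ∀ w, Cls b f g u0 W T w → ∀ q ∈ Q0set b, w q ≤ u q)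
    {φ : ℝ × ℝ → ℝ} (hφ : ContDiffOn ℝ 2 φ (Qset b)) {p : ℝ × ℝ} (hp : p ∈ Qset b)
    (hm : IsLocalMinOn (fun q => lscEnv b u q - φ q) (Qset b) p) : 0 ≤ EOp f g φ p := by
  by_contra hc
  push Not at hc
  have hp0 := Qset_sub_Q0 b hp
  have hQn := (isOpen_Qset b).mem_nhds hp
  have hφ2 : ContDiffOn ℝ 2 (fun q => φ q + - quart p q) (Qset b) :=
    hφ.add (quart_C2 p).contDiffOn.neg
  have hEc : ContinuousAt (EOp f g (fun q => φ q + - quart p q)) p :=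
    (EOp_cont hf hg hφ2).continuousAt hQn
  have hE : ∀ᶠ q in 𝓝 p, EOp f g (fun q => φ q + - quart p q) q < 0 :=
    hEc.eventually_lt_const (by rw [EOp_sub_quart hp hφ]; exact hc)
  have hm' := hm.isLocalMin hQn
  have hall : ∀ᶠ q in 𝓝 p, q ∈ Qset b ∧ EOp f g (fun q => φ q + - quart p q) q < 0 ∧
      lscEnv b u p - φ p ≤ lscEnv b u q - φ q := by
    filter_upwards [hQn, hE, hm'] with q h1 h2 h3 using ⟨h1, h2, h3⟩
  obtain ⟨r, hr, hB⟩ := Metric.nhds_basis_closedBall.eventually_iff.1 hall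
  set δ := (r / 2) ^ 4 / 2 with hδ
  have hδp : 0 < δ := by positivity
  set v := lscEnv b u with hv
  set ψ : ℝ × ℝ → ℝ := fun q => (φ q + - quart p q) + (v p - φ p + δ) with hψ
  have hψ2 : ContDiffOn ℝ 2 ψ (Qset b) := hφ2.add contDiffOn_const
  have hψE : ∀ q ∈ Metric.closedBall p r, EOp f g ψ q < 0 := by
    intro q hq
    rw [hψ, EOp_add_const]
    exact (hB hq).2.1
  have hBQ : ∀ q ∈ Metric.ball p r, q ∈ Qset b := fun q hq => (hB (Metric.ball_subset_closedBall hq)).1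
  have hring : ∀ q ∈ Metric.ball p r, r / 2 ≤ dist q p → ψ q ≤ u q := by
    intro q hq hd
    have h1 := quart_ge (by positivity) hd
    have h2 := (hB (Metric.ball_subset_closedBall hq)).2.2
    have h3 := lsc_le hu (Qset_sub_Q0 b (hBQ q hq))
    rw [← hv] at h3
    simp only [hψ]
    have : (r / 2) ^ 4 = 2 * δ := by rw [hδ]; ring
    linarith
  classical
  set w : ℝ × ℝ → ℝ := fun q => if q ∈ Metric.ball p r then max (u q) (ψ q) else u q with hw
  have huw : ∀ q, u q ≤ w q := by
    intro q; simp only [hw]; split_ifs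
    · exact le_max_left _ _
    · exact le_rfl
  have hwout : ∀ q, r / 2 < dist q p → w q = u q := by
    intro q hq
    simp only [hw]; split_ifs with h
    · exact max_eq_left (hring q h hq.le)
    · rfl
  obtain ⟨hC1, hC2, hC3, hC4⟩ := hC
  have hwC : Cls b f g u0 W T w := by
    refine ⟨?_, ?_, ?_, ?_⟩
    · intro q hq y hy
      by_cases hqb : q ∈ Metric.ball p r
      · have hy' : max (u q) (ψ q) < y := by simpa only [hw, if_pos hqb] using hy
        have h1 := hC1 q hq y (lt_of_le_of_lt (le_max_left _ _) hy')
        have h2 : ∀ᶠ q' in 𝓝[Q0set b] q, ψ q' < y :=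
          ((diffAt_of_C2 hψ2 (hBQ q hqb)).continuousAt.eventually_lt_const
            (lt_of_le_of_lt (le_max_right _ _) hy')).filter_mono nhdsWithin_le_nhds
        filter_upwards [h1, h2] with q' h1 h2
        simp only [hw]; split_ifs
        · exact max_lt h1 h2
        · exact h1
      · have hd : r / 2 < dist q p := by
          have : r ≤ dist q p := by simpa using hqb
          linarith
        rw [hwout q hd] at hy
        have h1 := hC1 q hq y hy
        have h2 : ∀ᶠ q' in 𝓝[Q0set b] q, r / 2 < dist q' p :=
          ((continuous_id.dist continuous_const).continuousAt.eventually_const_lt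
            hd).filter_mono nhdsWithin_le_nhds
        filter_upwards [h1, h2] with q' h1 h2
        rw [hwout q' h2]; exact h1
    · intro q hq
      by_cases he : u q = w q
      · exact (hC2 q hq).of_touch (Eventually.of_forall huw) he
      · have hqb : q ∈ Metric.ball p r := by
          by_contra hcon
          exact he (by simp only [hw, if_neg hcon])
        have hw2 : ψ q = w q := by
          simp only [hw, if_pos hqb] at he ⊢
          rcases max_choice (u q) (ψ q) with h | h
          · exact absurd h.symm he
          · exact h.symm
        refine (SubAt.classical hfm hgp hψ2 hq
          (hψE q (Metric.ball_subset_closedBall hqb)).le).of_touch ?_ hw2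
        apply Filter.Eventually.filter_mono nhdsWithin_le_nhds
        filter_upwards [Metric.isOpen_ball.mem_nhds hqb] with q' hq'
        simp only [hw, if_pos hq']
        exact le_max_right _ _
    · intro x hx
      have : (x, (0:ℝ)) ∉ Metric.ball p r := fun h => lt_irrefl (0:ℝ) (hBQ _ h).2
      simp only [hw, if_neg this]
      exact hC3 x hx
    · intro i
      obtain ⟨ρ, hρ, hl⟩ := hC4 i
      have m1 : (p.1 + r, p.2) ∈ Metric.closedBall p r := by
        simp [Prod.dist_eq, abs_of_pos hr, hr.le]
      have m2 : (p.1 - r, p.2) ∈ Metric.closedBall p r := by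
        simp [Prod.dist_eq, abs_of_pos hr, hr.le]
      have b1 := (hB m1).1.1
      have b2 := (hB m2).1.1
      simp only [mem_Ioo] at b1 b2
      refine ⟨max ρ (max |p.1 + r| |p.1 - r|), max_lt hρ (max_lt (abs_lt.2 b1) (abs_lt.2 b2)), ?_⟩
      intro x t h1 h2 h3 h4
      have hnb : (x, t) ∉ Metric.ball p r := by
        intro h
        rw [Metric.mem_ball, Prod.dist_eq, max_lt_iff, Real.dist_eq] at h
        have hx := abs_lt.1 h.1
        simp only at hx
        have k1 : |p.1 + r| ≤ |x| := ((le_max_left _ _).trans (le_max_right _ _)).trans h1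
        have k2 : |p.1 - r| ≤ |x| := ((le_max_right _ _).trans (le_max_right _ _)).trans h1
        rcases abs_cases x with ⟨e, _⟩ | ⟨e, _⟩
        · have := le_abs_self (p.1 + r); linarith
        · have := neg_abs_le (p.1 - r); linarith
      simp only [hw, if_neg hnb]
      exact hl x t ((le_max_left _ _).trans h1) h2 h3 h4
  have hψp : v p + δ / 2 < ψ p := by simp only [hψ, quart_self]; linarith
  have hev : ∀ᶠ q in 𝓝[Q0set b] p, v p + δ / 2 < ψ q ∧ q ∈ Metric.ball p r := by
    apply Filter.Eventually.filter_mono nhdsWithin_le_nhds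
    exact ((diffAt_of_C2 hψ2 hp).continuousAt.eventually_const_lt hψp).and
      (Metric.ball_mem_nhds p hr)
  have hfr : ∃ᶠ q in 𝓝[Q0set b] p, u q < v p + δ / 2 := by
    intro hcon
    have := le_lsc hu hp0 (hcon.mono fun q hq => not_lt.1 hq)
    linarith
  obtain ⟨q, hq1, hq2, hq3⟩ := (hfr.and_eventually hev).exists
  have h1 := hmaxl w hwC q (Qset_sub_Q0 b (hBQ q hq3))
  have h2 : ψ q ≤ w q := by
    simp only [hw, if_pos hq3]; exact le_max_right _ _
  linarith

/-- The Perron method. -/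
theorem perron {ι κ : Type*} {b : ℝ} {f g u0 : ℝ → ℝ} (hf : Continuous f) (hg : Continuous g)
    (hfm : StrictMono f) (hgp : ∀ s, 0 < g s)
    (W : ι → ℝ × ℝ → ℝ) (T : ι → ℝ) (V : κ → ℝ × ℝ → ℝ)
    (hWc : ∀ i, ContinuousOn (W i) (Q0set b)) (hW2 : ∀ i, ContDiffOn ℝ 2 (W i) (Qset b))
    (hWs : ∀ i, ∀ p ∈ Qset b, p.2 ≤ T i → 0 < EOp f g (W i) p)
    (hW0 : ∀ i, ∀ x ∈ Ioo (-b) b, u0 x ≤ W i (x, 0))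
    (hWa : ∀ x ∈ Ioo (-b) b, ∀ ε > 0, ∀ t, ∃ i, t < T i ∧ W i (x, 0) ≤ u0 x + ε)
    (hVc : ∀ j, ContinuousOn (V j) (Q0set b))
    (hVs : ∀ j, ∀ p ∈ Qset b, SubAt b f g (V j) p)
    (hV0 : ∀ j, ∀ x ∈ Ioo (-b) b, V j (x, 0) ≤ u0 x)
    (hVa : ∀ x ∈ Ioo (-b) b, ∀ ε > 0, ∃ j, u0 x - ε ≤ V j (x, 0))
    (hVl : ∀ j i, ∃ ρ < b, ∀ x t, ρ ≤ |x| → |x| < b → 0 ≤ t → t < T i → V j (x, t) ≤ W i (x, t))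
    (hBr : ∃ j, ∀ t > 0, Tendsto (fun x => V j (x, t)) (𝓝[<] b) atTop)
    (hBl : ∃ j, ∀ t > 0, Tendsto (fun x => V j (x, t)) (𝓝[>] (-b)) atTop) (hb : 0 < b) :
    ∃ u : ℝ × ℝ → ℝ, IsVSol b f g u0 u := by
  set S : Set (ℝ × ℝ → ℝ) := {w | Cls b f g u0 W T w} with hS
  have hVS : ∀ j, Cls b f g u0 W T (V j) := fun j =>
    ⟨(hVc j).upperSemicontinuousOn, hVs j, hV0 j, hVl j⟩
  obtain ⟨jr, hjr⟩ := hBr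
  obtain ⟨jl, hjl⟩ := hBl
  have hcmp : ∀ w, Cls b f g u0 W T w → ∀ i, ∀ p ∈ Q0set b, p.2 < T i → w p ≤ W i p := by
    intro w hw i
    exact comparison hw.1 hw.2.1 (hWc i) (hW2 i) (hWs i)
      (fun x hx => (hw.2.2.1 x hx).trans (hW0 i x hx)) (hw.2.2.2 i)
  have hbd : ∀ p ∈ Q0set b, BddAbove ((fun w : ℝ × ℝ → ℝ => w p) '' S) := by
    intro p hp
    obtain ⟨i, hi, -⟩ := hWa 0 ⟨by linarith, hb⟩ 1 one_pos p.2
    refine ⟨W i p, ?_⟩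
    rintro _ ⟨w, hw, rfl⟩
    exact hcmp w hw i p hp hi
  set u : ℝ × ℝ → ℝ := fun p => sSup ((fun w : ℝ × ℝ → ℝ => w p) '' S) with hu
  have hle : ∀ w ∈ S, ∀ q ∈ Q0set b, w q ≤ u q := fun w hw q hq =>
    le_csSup (hbd q hq) ⟨w, hw, rfl⟩
  have hsup : ∀ q ∈ Q0set b, ∀ a < u q, ∃ w ∈ S, a < w q := by
    intro q hq a ha
    obtain ⟨_, ⟨w, hw, rfl⟩, h⟩ := exists_lt_of_lt_csSup (⟨_, ⟨V jr, hVS jr, rfl⟩⟩ : ((fun w : ℝ × ℝ → ℝ => w q) '' S).Nonempty) ha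
    exact ⟨w, hw, h⟩
  have huW : ∀ i, ∀ p ∈ Q0set b, p.2 < T i → u p ≤ W i p := by
    intro i p hp hi
    refine csSup_le (⟨_, ⟨V jr, hVS jr, rfl⟩⟩ : ((fun w : ℝ × ℝ → ℝ => w p) '' S).Nonempty) ?_
    rintro _ ⟨w, hw, rfl⟩
    exact hcmp w hw i p hp hi
  have htime : ∀ (p : ℝ × ℝ) (τ : ℝ), p.2 < τ → ∀ᶠ q in 𝓝[Q0set b] p, q.2 < τ := fun p τ h =>
    (continuous_snd.continuousAt.eventually_lt_const h).filter_mono nhdsWithin_le_nhds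
  have hLB : LB b u := by
    intro p hp
    constructor
    · refine ⟨V jr p - 1, ?_⟩
      have := (hVc jr p hp).eventually_const_lt (show V jr p - 1 < V jr p by linarith)
      filter_upwards [this, self_mem_nhdsWithin] with q h1 h2
      exact h1.le.trans (hle _ (hVS jr) q h2)
    · obtain ⟨i, hi, -⟩ := hWa 0 ⟨by linarith, hb⟩ 1 one_pos p.2
      refine ⟨W i p + 1, ?_⟩
      have := (hWc i p hp).eventually_lt_const (show W i p < W i p + 1 by linarith)
      filter_upwards [this, self_mem_nhdsWithin, htime p _ hi] with q h1 h2 h3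
      exact (huW i q h2 h3).trans h1.le
  have husW : ∀ i, ∀ p ∈ Q0set b, p.2 < T i → uscEnv b u p ≤ W i p := by
    intro i p hp hi
    apply le_of_forall_pos_le_add
    intro ε hε
    apply usc_le hLB hp
    have := (hWc i p hp).eventually_lt_const (show W i p < W i p + ε by linarith)
    filter_upwards [this, self_mem_nhdsWithin, htime p _ hi] with q h1 h2 h3
    exact (huW i q h2 h3).trans h1.le
  have hlsV : ∀ j, ∀ p ∈ Q0set b, V j p ≤ lscEnv b u p := by
    intro j p hp
    apply le_of_forall_lt
    intro a ha
    obtain ⟨a', h1, h2⟩ := exists_between ha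
    refine h1.trans_le (le_lsc hLB hp ?_)
    filter_upwards [(hVc j p hp).eventually_const_lt h2, self_mem_nhdsWithin] with q h3 h4
    exact h3.le.trans (hle _ (hVS j) q h4)
  have hmem0 : ∀ x ∈ Ioo (-b) b, ((x, 0) : ℝ × ℝ) ∈ Q0set b := fun x hx => ⟨hx, le_refl (0:ℝ)⟩
  have hu0 : ∀ x ∈ Ioo (-b) b, uscEnv b u (x, 0) ≤ u0 x := by
    intro x hx
    apply le_of_forall_pos_le_add
    intro ε hε
    obtain ⟨i, hi, hi2⟩ := hWa x hx ε hε 0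
    exact (husW i _ (hmem0 x hx) hi).trans hi2
  have hl0 : ∀ x ∈ Ioo (-b) b, u0 x ≤ lscEnv b u (x, 0) := by
    intro x hx
    apply le_of_forall_pos_le_add
    intro ε hε
    obtain ⟨j, hj⟩ := hVa x hx ε hε
    have := hlsV j _ (hmem0 x hx)
    linarith
  have hsub : ∀ p ∈ Qset b, SubAt b f g (uscEnv b u) p :=
    sup_stable hf hg hLB (fun w hw => hw.1) (fun w hw => hw.2.1) hle hsup
  have hlatW : ∀ i, ∃ ρ < b, ∀ x t, ρ ≤ |x| → |x| < b → 0 ≤ t → t < T i →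
      uscEnv b u (x, t) ≤ W i (x, t) := by
    intro i
    refine ⟨0, hb, fun x t _ h2 h3 h4 => husW i (x, t) ⟨abs_lt.1 h2, h3⟩ h4⟩
  have husC : Cls b f g u0 W T (uscEnv b u) := ⟨usc_usc hLB, hsub, hu0, hlatW⟩
  have heq : ∀ q ∈ Q0set b, uscEnv b u q = u q := fun q hq =>
    le_antisymm (hle _ husC q hq) (le_usc hLB hq)
  have huC : Cls b f g u0 W T u := by
    refine ⟨?_, ?_, ?_, ?_⟩
    · intro q hq y hy
      rw [← heq q hq] at hy
      filter_upwards [usc_usc hLB q hq y hy, self_mem_nhdsWithin] with q' h1 h2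
      rwa [← heq q' h2]
    · intro p hp
      refine (hsub p hp).of_touch ?_ (heq p (Qset_sub_Q0 b hp))
      filter_upwards [self_mem_nhdsWithin] with q hq
      exact (heq q (Qset_sub_Q0 b hq)).le
    · intro x hx
      rw [← heq _ (hmem0 x hx)]
      exact hu0 x hx
    · intro i
      refine ⟨0, hb, fun x t _ h2 h3 h4 => huW i (x, t) ⟨abs_lt.1 h2, h3⟩ h4⟩
  have hlu : ∀ p ∈ Q0set b, lscEnv b u p ≤ uscEnv b u p := fun p hp =>
    (lsc_le hLB hp).trans (le_usc hLB hp)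
  refine ⟨u, ⟨usc_usc hLB, fun φ hφ p hp hm => hsub p hp φ hφ hm⟩, ⟨lsc_lsc hLB, ?_, ?_⟩, ?_⟩
  · intro φ hφ p hp hm
    exact bump hf hg hfm hgp hLB huC (fun w hw => hle w hw) hφ hp hm
  · intro t ht
    constructor
    · apply tendsto_atTop_mono' _ _ (hjr t ht)
      filter_upwards [Ioo_mem_nhdsLT (show -b < b by linarith)] with x hx
      exact hlsV jr (x, t) ⟨hx, ht.le⟩
    · apply tendsto_atTop_mono' _ _ (hjl t ht)
      filter_upwards [Ioo_mem_nhdsGT (show -b < b by linarith)] with x hx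
      exact hlsV jl (x, t) ⟨hx, ht.le⟩
  · intro x hx
    have h1 := hu0 x hx
    have h2 := hl0 x hx
    have h3 := hlu _ (hmem0 x hx)
    exact ⟨by linarith, by linarith⟩

theorem g_bounds {g : ℝ → ℝ} {α : ℝ} (hg : A2 g α) : ∃ c C R : ℝ, 0 < c ∧ 0 < C ∧ 1 ≤ R ∧
    ∀ s, R ≤ |s| → c * |s| ^ (-α) ≤ g s ∧ g s ≤ C * |s| ^ (-α) := by
  obtain ⟨-, hpos, Cp, Cm, hp, hm, h1, h2⟩ := hg
  have e1 : ∀ᶠ s in atTop, Cp / 2 < |s| ^ α * g s ∧ |s| ^ α * g s < 2 * Cp :=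
    (h1.eventually_const_lt (by linarith)).and (h1.eventually_lt_const (by linarith))
  have e2 : ∀ᶠ s in atBot, Cm / 2 < |s| ^ α * g s ∧ |s| ^ α * g s < 2 * Cm :=
    (h2.eventually_const_lt (by linarith)).and (h2.eventually_lt_const (by linarith))
  obtain ⟨R1, hR1⟩ := eventually_atTop.1 e1
  obtain ⟨R2, hR2⟩ := eventually_atBot.1 e2
  refine ⟨min (Cp / 2) (Cm / 2), max (2 * Cp) (2 * Cm), max 1 (max R1 (-R2)),
    lt_min (by linarith) (by linarith), lt_max_of_lt_left (by linarith), le_max_left _ _, ?_⟩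
  intro s hs
  have hs1 : 1 ≤ |s| := (le_max_left _ _).trans hs
  have hs2 : R1 ≤ |s| := ((le_max_left _ _).trans (le_max_right _ _)).trans hs
  have hs3 : -R2 ≤ |s| := ((le_max_right _ _).trans (le_max_right _ _)).trans hs
  have hs0 : 0 < |s| := by linarith
  have key : min (Cp / 2) (Cm / 2) ≤ |s| ^ α * g s ∧ |s| ^ α * g s ≤ max (2 * Cp) (2 * Cm) := by
    rcases le_total 0 s with h | h
    · have := hR1 s (by rwa [abs_of_nonneg h] at hs2)
      exact ⟨(min_le_left _ _).trans this.1.le, this.2.le.trans (le_max_left _ _)⟩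
    · have := hR2 s (by rw [abs_of_nonpos h] at hs3; linarith)
      exact ⟨(min_le_right _ _).trans this.1.le, this.2.le.trans (le_max_right _ _)⟩
  have hpw : 0 < |s| ^ α := Real.rpow_pos_of_pos hs0 _
  rw [Real.rpow_neg hs0.le, ← div_eq_mul_inv, ← div_eq_mul_inv, div_le_iff₀ hpw, le_div_iff₀ hpw,
    mul_comm (g s)]
  exact key

theorem f_upper {f : ℝ → ℝ} {β : ℝ} (hf : A1 f) (hf3 : A3 f β) :
    ∃ C : ℝ, 0 < C ∧ ∀ s, 0 ≤ s → f s ≤ C * (1 + s ^ β) := by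
  obtain ⟨-, hm, h0, -, -⟩ := hf
  obtain ⟨hβ, Cp, -, hp, -, h1, -⟩ := hf3
  obtain ⟨R, hR⟩ := eventually_atTop.1 (h1.eventually_lt_const (show Cp < 2 * Cp by linarith))
  set R' := max R 1 with hR'
  have hfR : 0 < f R' := by rw [← h0]; exact hm (lt_of_lt_of_le one_pos (le_max_right _ _))
  refine ⟨2 * Cp + f R', by linarith, ?_⟩
  intro s hs
  have hsb : 0 ≤ s ^ β := Real.rpow_nonneg hs _
  rcases le_total s R' with h | h
  · have := hm.monotone h
    nlinarith
  · have h2 := hR s ((le_max_left _ _).trans h)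
    have hs0 : 0 < s := lt_of_lt_of_le one_pos ((le_max_right _ _).trans h)
    rw [abs_of_pos hs0, Real.rpow_neg hs, inv_mul_lt_iff₀ (Real.rpow_pos_of_pos hs0 _)] at h2
    nlinarith

theorem f_lower {f : ℝ → ℝ} {β : ℝ} (hf : A1 f) (hf3 : A3 f β) {s1 : ℝ} (hs1 : 0 < s1) :
    ∃ c : ℝ, 0 < c ∧ ∀ s, s1 ≤ s → c * s ^ β ≤ f s := by
  obtain ⟨-, hm, h0, -, -⟩ := hf
  obtain ⟨hβ, Cp, -, hp, -, h1, -⟩ := hf3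
  obtain ⟨R, hR⟩ := eventually_atTop.1 (h1.eventually_const_lt (show Cp / 2 < Cp by linarith))
  set R' := max R 1 with hR'
  have hR0 : 0 < R' := lt_of_lt_of_le one_pos (le_max_right _ _)
  have hfs : 0 < f s1 := by rw [← h0]; exact hm hs1
  have hRb : 0 < R' ^ β := Real.rpow_pos_of_pos hR0 _
  refine ⟨min (Cp / 2) (f s1 / R' ^ β), lt_min (by linarith) (by positivity), ?_⟩
  intro s hs
  have hs0 : 0 < s := by linarith
  have hsb : 0 < s ^ β := Real.rpow_pos_of_pos hs0 _
  rcases le_total s R' with h | h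
  · have e1 := hm.monotone hs
    have e2 : s ^ β ≤ R' ^ β := Real.rpow_le_rpow hs0.le h hβ.le
    calc _ ≤ f s1 / R' ^ β * R' ^ β := by
          apply mul_le_mul (min_le_right _ _) e2 hsb.le (by positivity)
      _ = f s1 := by field_simp
      _ ≤ f s := e1
  · have h2 := hR s ((le_max_left _ _).trans h)
    rw [abs_of_pos hs0, Real.rpow_neg hs0.le, lt_inv_mul_iff₀ hsb] at h2
    have : min (Cp / 2) (f s1 / R' ^ β) * s ^ β ≤ Cp / 2 * s ^ β :=
      mul_le_mul_of_nonneg_right (min_le_left _ _) hsb.le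
    linarith

theorem pow_dom (e : ℝ) (k : ℕ) (he : e < k + 1) (C C' η : ℝ) (hη : 0 < η) :
    ∃ R : ℝ, 1 ≤ R ∧ ∀ z, R ≤ z → C + C' * z ^ e ≤ η * z ^ (k + 1) := by
  have t1 : Tendsto (fun z : ℝ => C * z ^ (-((k:ℝ) + 1)) + C' * z ^ (-((k:ℝ) + 1 - e))) atTop
      (𝓝 (C * 0 + C' * 0)) :=
    ((tendsto_rpow_neg_atTop (by positivity)).const_mul C).add
      ((tendsto_rpow_neg_atTop (by linarith)).const_mul C')
  obtain ⟨R, hR⟩ := eventually_atTop.1 (t1.eventually_lt_const (show C * 0 + C' * 0 < η by simpa using hη))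
  refine ⟨max R 1, le_max_right _ _, fun z hz => ?_⟩
  have hz0 : 0 < z := lt_of_lt_of_le one_pos ((le_max_right _ _).trans hz)
  have h := hR z ((le_max_left _ _).trans hz)
  have hp : 0 < z ^ ((k:ℝ) + 1) := Real.rpow_pos_of_pos hz0 _
  have e1 : z ^ (-((k:ℝ) + 1)) * z ^ ((k:ℝ) + 1) = 1 := by
    rw [← Real.rpow_add hz0]; simp
  have e2 : z ^ (-((k:ℝ) + 1 - e)) * z ^ ((k:ℝ) + 1) = z ^ e := by
    rw [← Real.rpow_add hz0]; congr 1; ring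
  have e3 : z ^ ((k:ℝ) + 1) = z ^ (k + 1) := by
    rw [← Real.rpow_natCast]; push_cast; rfl
  rw [← e3]
  calc C + C' * z ^ e = (C * z ^ (-((k:ℝ) + 1)) + C' * z ^ (-((k:ℝ) + 1 - e))) * z ^ ((k:ℝ) + 1) := by
        rw [add_mul, mul_assoc, mul_assoc, e1, e2, mul_one]
    _ ≤ _ := mul_le_mul_of_nonneg_right h.le hp.le

theorem lat_phi {b : ℝ} (hb : 0 < b) (R : ℝ) (hR : 0 < R) :
    ∃ ρ < b, 0 ≤ ρ ∧ ∀ x, ρ ≤ |x| → |x| < b → R ≤ (b ^ 2 - x ^ 2)⁻¹ := by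
  have hd : 0 < 1 / (2 * b * R) := by positivity
  refine ⟨max 0 (b - 1 / (2 * b * R)), max_lt hb (by linarith), le_max_left _ _, ?_⟩
  intro x h1 h2
  have h3 : b - 1 / (2 * b * R) ≤ |x| := (le_max_right _ _).trans h1
  have hq : 0 < b ^ 2 - x ^ 2 := by
    rw [← sq_abs x]; nlinarith [abs_nonneg x]
  rw [le_inv_comm₀ hR hq]
  have : b ^ 2 - x ^ 2 ≤ 2 * b * (b - |x|) := by
    rw [← sq_abs x]; nlinarith [abs_nonneg x]
  calc b ^ 2 - x ^ 2 ≤ 2 * b * (b - |x|) := this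
    _ ≤ 2 * b * (1 / (2 * b * R)) := by
        apply mul_le_mul_of_nonneg_left (by linarith) (by positivity)
    _ = R⁻¹ := by field_simp

theorem rpow_two_sided {a1 a2 X Y e : ℝ} (h1 : 0 < a1) (hX : 0 < X) (hl : a1 * X ≤ Y)
    (hu : Y ≤ a2 * X) : Y ^ e ≤ max (a1 ^ e) (a2 ^ e) * X ^ e := by
  have hY : 0 < Y := lt_of_lt_of_le (by positivity) hl
  have h2 : 0 < a2 := by
    by_contra h
    have : a2 * X ≤ 0 := mul_nonpos_of_nonpos_of_nonneg (not_lt.1 h) hX.le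
    linarith
  have hXe : 0 ≤ X ^ e := Real.rpow_nonneg hX.le _
  rcases le_total 0 e with he | he
  · calc Y ^ e ≤ (a2 * X) ^ e := Real.rpow_le_rpow hY.le hu he
      _ = a2 ^ e * X ^ e := Real.mul_rpow h2.le hX.le
      _ ≤ _ := mul_le_mul_of_nonneg_right (le_max_right _ _) hXe
  · calc Y ^ e ≤ (a1 * X) ^ e := Real.rpow_le_rpow_of_nonpos (by positivity) hl he
      _ = a1 ^ e * X ^ e := Real.mul_rpow h1.le hX.le
      _ ≤ _ := mul_le_mul_of_nonneg_right (le_max_left _ _) hXe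

/-- `x`-derivative of the super-barrier. -/
def dW (b M y η : ℝ) (k : ℕ) (p : ℝ × ℝ) : ℝ :=
  2 * M * (p.1 - y) + η * (1 + p.2) * (2 * (k + 1) * p.1 * ((b ^ 2 - p.1 ^ 2)⁻¹) ^ (k + 2))

/-- second `x`-derivative of the super-barrier. -/
def ddW (b M η : ℝ) (k : ℕ) (p : ℝ × ℝ) : ℝ :=
  2 * M + η * (1 + p.2) * (2 * (k + 1) * (((b ^ 2 - p.1 ^ 2)⁻¹) ^ (k + 2) +
    2 * (k + 2) * p.1 ^ 2 * ((b ^ 2 - p.1 ^ 2)⁻¹) ^ (k + 3)))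

set_option maxHeartbeats 1000000 in
theorem super_far {b α β : ℝ} {f g : ℝ → ℝ} (hb : 0 < b) (hf : A1 f) (hf3 : A3 f β) (hg : A2 g α)
    (k : ℕ) (he : β * ((k + 3) - α * (k + 2)) < k + 1) {M η T y : ℝ} (hM : 0 ≤ M) (hη : 0 < η)
    (hT : 0 ≤ T) (hy : y ∈ Ioo (-b) b) :
    ∃ R : ℝ, 1 ≤ R ∧ ∀ x t, |x| < b → 0 ≤ t → t ≤ T → R ≤ (b ^ 2 - x ^ 2)⁻¹ →
      f (g (dW b M y η k (x, t)) * ddW b M η k (x, t)) ≤ η * ((b ^ 2 - x ^ 2)⁻¹) ^ (k + 1) := by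
  obtain ⟨cg, Cg, Rg, hcg, hCg, hRg, hgb⟩ := g_bounds hg
  obtain ⟨Cf, hCf, hfu⟩ := f_upper hf hf3
  have hβ : 0 < β := hf3.1
  set a1 : ℝ := η * (k + 1) * b / 2 with ha1
  have ha1p : 0 < a1 := by positivity
  set a2 : ℝ := 4 * M * b + η * (1 + T) * (2 * (k + 1) * b) with ha2
  set B : ℝ := 2 * M + η * (1 + T) * (2 * (k + 1) * (1 + 2 * (k + 2) * b ^ 2)) with hB
  have hBp : 0 < B := by positivity
  set D : ℝ := max (a1 ^ (-α)) (a2 ^ (-α)) with hD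
  have hDp : 0 < D := lt_max_of_lt_left (Real.rpow_pos_of_pos ha1p _)
  set C1 : ℝ := Cg * D * B with hC1
  have hC1p : 0 < C1 := by positivity
  obtain ⟨R0, hR0, hdom⟩ := pow_dom (β * ((k + 3) - α * (k + 2))) k he Cf (Cf * C1 ^ β) η hη
  set R : ℝ := max R0 (max (4 * M * b / a1) (max (Rg / a1) (4 / (3 * b ^ 2)))) with hR
  refine ⟨R, hR0.trans (le_max_left _ _), ?_⟩
  intro x t hx ht0 htT hΦ
  set Φ := (b ^ 2 - x ^ 2)⁻¹ with hΦdef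
  have r0 : R0 ≤ Φ := (le_max_left _ _).trans hΦ
  have r1 : 4 * M * b / a1 ≤ Φ := ((le_max_left _ _).trans (le_max_right _ _)).trans hΦ
  have r2 : Rg / a1 ≤ Φ :=
    (((le_max_left _ _).trans (le_max_right _ _)).trans (le_max_right _ _)).trans hΦ
  have r3 : 4 / (3 * b ^ 2) ≤ Φ :=
    (((le_max_right _ _).trans (le_max_right _ _)).trans (le_max_right _ _)).trans hΦ
  have hΦ1 : 1 ≤ Φ := hR0.trans r0
  have hΦ0 : 0 < Φ := by linarith
  have hq : 0 < b ^ 2 - x ^ 2 := by rw [← sq_abs x]; nlinarith [abs_nonneg x]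
  have hxb : b / 2 ≤ |x| := by
    by_contra hcon
    push Not at hcon
    have h1 : 3 * b ^ 2 / 4 < b ^ 2 - x ^ 2 := by rw [← sq_abs x]; nlinarith [abs_nonneg x]
    have h2 : Φ < (3 * b ^ 2 / 4)⁻¹ := inv_strictAnti₀ (by positivity) h1
    rw [inv_div] at h2
    linarith
  set X := Φ ^ (k + 2) with hX
  have hX0 : 0 < X := by positivity
  have hXΦ : Φ ≤ X := le_self_pow₀ hΦ1 (by omega)
  have hX1 : 1 ≤ X := hΦ1.trans hXΦ
  have hxy : |x - y| ≤ 2 * b := by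
    have := abs_lt.2 hy
    calc |x - y| ≤ |x| + |y| := abs_sub x y
      _ ≤ 2 * b := by linarith
  set P := dW b M y η k (x, t) with hP
  have hPe : P = 2 * M * (x - y) + η * (1 + t) * (2 * (k + 1) * x * X) := rfl
  have hA : |2 * M * (x - y)| ≤ 4 * M * b := by
    rw [abs_mul, abs_of_nonneg (by positivity)]
    calc 2 * M * |x - y| ≤ 2 * M * (2 * b) := mul_le_mul_of_nonneg_left hxy (by positivity)
      _ = _ := by ring
  have hS : |η * (1 + t) * (2 * (k + 1) * x * X)| = η * (1 + t) * (2 * (k + 1) * X) * |x| := by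
    rw [show η * (1 + t) * (2 * (k + 1) * x * X) = η * (1 + t) * (2 * (k + 1) * X) * x by ring,
      abs_mul, abs_of_nonneg (by positivity)]
  have hlow : a1 * X ≤ |P| := by
    have h1 : |η * (1 + t) * (2 * (k + 1) * x * X)| - |2 * M * (x - y)| ≤ |P| := by
      rw [hPe, add_comm (2 * M * (x - y))]
      have := abs_sub_abs_le_abs_sub (η * (1 + t) * (2 * (k + 1) * x * X)) (-(2 * M * (x - y)))
      rwa [abs_neg, sub_neg_eq_add] at this
    have h2 : 2 * (a1 * X) ≤ |η * (1 + t) * (2 * (k + 1) * x * X)| := by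
      rw [hS]
      calc 2 * (a1 * X) = η * 1 * (2 * (k + 1) * X) * (b / 2) := by rw [ha1]; ring
        _ ≤ _ := by gcongr; linarith
    have h3 : 4 * M * b ≤ a1 * X := by
      rw [div_le_iff₀ ha1p] at r1
      have h4 := mul_le_mul_of_nonneg_left hXΦ ha1p.le
      linarith [mul_comm Φ a1]
    linarith
  have hup : |P| ≤ a2 * X := by
    have h1 : |P| ≤ |2 * M * (x - y)| + |η * (1 + t) * (2 * (k + 1) * x * X)| := by
      rw [hPe]; exact abs_add_le _ _
    have h2 : |η * (1 + t) * (2 * (k + 1) * x * X)| ≤ η * (1 + T) * (2 * (k + 1) * X) * b := by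
      rw [hS]; gcongr
    have h3 : 4 * M * b ≤ 4 * M * b * X := le_mul_of_one_le_right (by positivity) hX1
    calc |P| ≤ 4 * M * b * X + η * (1 + T) * (2 * (k + 1) * X) * b := by linarith
      _ = a2 * X := by rw [ha2]; ring
  have hPR : Rg ≤ |P| := by
    rw [div_le_iff₀ ha1p] at r2
    have h4 := mul_le_mul_of_nonneg_left hXΦ ha1p.le
    linarith [mul_comm Φ a1]
  have hgP : g P ≤ Cg * (D * X ^ (-α)) :=
    ((hgb P hPR).2).trans (mul_le_mul_of_nonneg_left (rpow_two_sided ha1p hX0 hlow hup) hCg.le)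
  have hdd : ddW b M η k (x, t) ≤ B * Φ ^ (k + 3) := by
    have hx2 : x ^ 2 ≤ b ^ 2 := by linarith
    have h1 : X ≤ Φ ^ (k + 3) := pow_le_pow_right₀ hΦ1 (by omega)
    have h2 : 1 ≤ Φ ^ (k + 3) := hX1.trans h1
    calc ddW b M η k (x, t) = 2 * M * 1 + η * (1 + t) * (2 * (k + 1) * (X +
            2 * (k + 2) * x ^ 2 * Φ ^ (k + 3))) := by simp only [ddW, hX, hΦdef]; ring
      _ ≤ 2 * M * Φ ^ (k + 3) + η * (1 + T) * (2 * (k + 1) * (Φ ^ (k + 3) +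
            2 * (k + 2) * b ^ 2 * Φ ^ (k + 3))) := by gcongr
      _ = B * Φ ^ (k + 3) := by rw [hB]; ring
  have hdd0 : 0 ≤ ddW b M η k (x, t) := by
    simp only [ddW]
    rw [← hΦdef]; positivity
  have hs : g P * ddW b M η k (x, t) ≤ C1 * Φ ^ ((k + 3 : ℝ) - α * (k + 2)) := by
    have e1 : X ^ (-α) * Φ ^ (k + 3) = Φ ^ ((k + 3 : ℝ) - α * (k + 2)) := by
      rw [hX, ← Real.rpow_natCast, ← Real.rpow_natCast, ← Real.rpow_mul hΦ0.le, ← Real.rpow_add hΦ0]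
      congr 1; push_cast; ring
    calc g P * ddW b M η k (x, t) ≤ Cg * (D * X ^ (-α)) * (B * Φ ^ (k + 3)) :=
          mul_le_mul hgP hdd hdd0 (by positivity)
      _ = C1 * (X ^ (-α) * Φ ^ (k + 3)) := by rw [hC1]; ring
      _ = _ := by rw [e1]
  have hs0 : 0 ≤ g P * ddW b M η k (x, t) := mul_nonneg (hg.2.1 P).le hdd0
  have hE : (C1 * Φ ^ ((k + 3 : ℝ) - α * (k + 2))) ^ β =
      C1 ^ β * Φ ^ (β * ((k + 3 : ℝ) - α * (k + 2))) := by
    rw [Real.mul_rpow hC1p.le (by positivity), ← Real.rpow_mul hΦ0.le, mul_comm β]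
  calc f (g P * ddW b M η k (x, t)) ≤ Cf * (1 + (g P * ddW b M η k (x, t)) ^ β) := hfu _ hs0
    _ ≤ Cf * (1 + (C1 * Φ ^ ((k + 3 : ℝ) - α * (k + 2))) ^ β) := by gcongr
    _ = Cf + Cf * C1 ^ β * Φ ^ (β * ((k + 3 : ℝ) - α * (k + 2))) := by rw [hE]; ring
    _ ≤ _ := hdom Φ r0

theorem super_bound {b α β : ℝ} {f g : ℝ → ℝ} (hb : 0 < b) (hf : A1 f) (hf3 : A3 f β) (hg : A2 g α)
    (k : ℕ) (he : β * ((k + 3) - α * (k + 2)) < k + 1) {M η T y : ℝ} (hM : 0 ≤ M) (hη : 0 < η)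
    (hT : 0 ≤ T) (hy : y ∈ Ioo (-b) b) :
    ∃ G : ℝ, 0 ≤ G ∧ ∀ x t, |x| < b → 0 ≤ t → t ≤ T →
      f (g (dW b M y η k (x, t)) * ddW b M η k (x, t)) <
        G + η * ((b ^ 2 - x ^ 2)⁻¹) ^ (k + 1) := by
  obtain ⟨R, hR, hfar⟩ := super_far hb hf hf3 hg k he hM hη hT hy
  set K : Set (ℝ × ℝ) := (Icc (-b) b ∩ {x | R⁻¹ ≤ b ^ 2 - x ^ 2}) ×ˢ Icc 0 T with hK
  have hKc : IsCompact K := by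
    apply IsCompact.prod _ isCompact_Icc
    exact isCompact_Icc.inter_right (isClosed_le continuous_const (by fun_prop))
  have hne : ∀ p ∈ K, b ^ 2 - p.1 ^ 2 ≠ 0 := by
    intro p hp
    have h1 : R⁻¹ ≤ b ^ 2 - p.1 ^ 2 := hp.1.2
    have : 0 < R⁻¹ := by positivity
    linarith
  have c0 : ContinuousOn (fun p : ℝ × ℝ => (b ^ 2 - p.1 ^ 2)⁻¹) K :=
    ContinuousOn.inv₀ (by fun_prop) hne
  have c1 : ContinuousOn (dW b M y η k) K := by
    unfold dW; fun_prop
  have c2 : ContinuousOn (ddW b M η k) K := by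
    unfold ddW; fun_prop
  have c3 : ContinuousOn (fun p => f (g (dW b M y η k p) * ddW b M η k p)) K :=
    hf.1.comp_continuousOn ((hg.1.comp_continuousOn c1).mul c2)
  obtain ⟨G0, hG0⟩ := hKc.bddAbove_image c3
  refine ⟨max G0 0 + 1, by positivity, ?_⟩
  intro x t hx h0 h1
  have hq : 0 < b ^ 2 - x ^ 2 := by rw [← sq_abs x]; nlinarith [abs_nonneg x]
  have hΦ : 0 < (b ^ 2 - x ^ 2)⁻¹ ^ (k + 1) := by positivity
  have m1 := le_max_left G0 0
  have m2 := le_max_right G0 0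
  rcases le_total R (b ^ 2 - x ^ 2)⁻¹ with h | h
  · have := hfar x t hx h0 h1 h
    linarith
  · have hmem : (x, t) ∈ K := by
      have hx' := abs_le.1 hx.le
      refine ⟨⟨hx', ?_⟩, h0, h1⟩
      exact (inv_le_comm₀ hq (by positivity)).1 h
    have := hG0 (mem_image_of_mem _ hmem)
    have h3 : 0 < η * (b ^ 2 - x ^ 2)⁻¹ ^ (k + 1) := by positivity
    linarith

theorem q_pos {b x : ℝ} (hx : |x| < b) : 0 < b ^ 2 - x ^ 2 := by
  rw [← sq_abs x]; nlinarith [abs_nonneg x]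

theorem inv_dist_le {b x : ℝ} (hx : |x| < b) :
    (b - x)⁻¹ ≤ 2 * b * (b ^ 2 - x ^ 2)⁻¹ ∧ (b + x)⁻¹ ≤ 2 * b * (b ^ 2 - x ^ 2)⁻¹ := by
  have hq := q_pos hx
  obtain ⟨h1, h2⟩ := abs_lt.1 hx
  have e1 : 0 < b - x := by linarith
  have e2 : 0 < b + x := by linarith
  have e3 : b ^ 2 - x ^ 2 = (b - x) * (b + x) := by ring
  rw [e3]
  constructor
  · rw [← div_eq_mul_inv, le_div_iff₀ (by positivity)]
    field_simp; linarith
  · rw [← div_eq_mul_inv, le_div_iff₀ (by positivity)]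
    field_simp; linarith

theorem dist_rpow_le {b x d e : ℝ} (hx : |x| < b) (he : 0 ≤ e) (hd : 0 < d)
    (h : d⁻¹ ≤ 2 * b * (b ^ 2 - x ^ 2)⁻¹) :
    d ^ (-e) ≤ (2 * b) ^ e * ((b ^ 2 - x ^ 2)⁻¹) ^ e := by
  have hq := q_pos hx
  have hb : 0 < b := (abs_nonneg x).trans_lt hx
  rw [Real.rpow_neg hd.le, ← Real.inv_rpow hd.le, ← Real.mul_rpow (by positivity) (by positivity)]
  exact Real.rpow_le_rpow (by positivity) h he

theorem u0_facts {b : ℝ} {u0 : ℝ → ℝ} (hb : 0 < b) (hu0 : B1 b u0 ∨ B2 b u0) :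
    ContinuousOn u0 (Ioo (-b) b) ∧ (∃ m : ℝ, ∀ x ∈ Ioo (-b) b, -m ≤ u0 x) ∧
    ∃ γ C C' ρ : ℝ, ρ < b ∧ ∀ x, ρ ≤ |x| → |x| < b → u0 x ≤ C + C' * ((b ^ 2 - x ^ 2)⁻¹) ^ γ := by
  rcases hu0 with h | h
  · refine ⟨h.mono Ioo_subset_Icc_self, ?_, ?_⟩
    · obtain ⟨m, hm⟩ := isCompact_Icc.bddBelow_image h
      exact ⟨-m, fun x hx => by
        rw [neg_neg]; exact hm (mem_image_of_mem _ (Ioo_subset_Icc_self hx))⟩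
    · obtain ⟨m, hm⟩ := isCompact_Icc.bddAbove_image h
      refine ⟨1, m, 0, 0, hb, fun x _ hx => ?_⟩
      rw [zero_mul, add_zero]
      exact hm (mem_image_of_mem _ (abs_le.1 hx.le))
  · obtain ⟨hc, hr, hl, γ, hγ, ⟨C1, h1⟩, ⟨C2, h2⟩⟩ := h
    have er := (hr.eventually_ge_atTop 0).and h1
    have el := (hl.eventually_ge_atTop 0).and h2
    obtain ⟨l, hlb, hl'⟩ := (mem_nhdsLT_iff_exists_Ioo_subset).1 er
    obtain ⟨r, hrb, hr'⟩ := (mem_nhdsGT_iff_exists_Ioo_subset).1 el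
    simp only [mem_Iio, mem_Ioi] at hlb hrb
    have hmx : max l (-r) < b := max_lt hlb (by linarith)
    set ρ := (max l (-r) + b) / 2 with hρ
    have hρb : ρ < b := by linarith
    have hρl : l < ρ := by have := le_max_left l (-r); linarith
    have hρr : -r < ρ := by have := le_max_right l (-r); linarith
    have hside : ∀ x, ρ ≤ |x| → |x| < b → 0 ≤ u0 x ∧
        u0 x ≤ 0 + (|C1| + |C2|) * (2 * b) ^ γ * ((b ^ 2 - x ^ 2)⁻¹) ^ γ := by
      intro x hx hxb
      have hP : 0 ≤ (2 * b) ^ γ * ((b ^ 2 - x ^ 2)⁻¹) ^ γ := by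
        have := q_pos hxb; positivity
      obtain ⟨b1, b2⟩ := abs_lt.1 hxb
      have gen : ∀ d C, 0 < d → d⁻¹ ≤ 2 * b * (b ^ 2 - x ^ 2)⁻¹ → u0 x * d ^ γ ≤ C →
          u0 x ≤ |C| * ((2 * b) ^ γ * ((b ^ 2 - x ^ 2)⁻¹) ^ γ) := by
        intro d C hd h3 h4
        have h5 := dist_rpow_le hxb hγ.le hd h3
        have h6 : 0 < d ^ γ := Real.rpow_pos_of_pos hd _
        calc u0 x ≤ C / d ^ γ := by rwa [le_div_iff₀ h6]
          _ = C * d ^ (-γ) := by rw [Real.rpow_neg hd.le]; rfl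
          _ ≤ |C| * d ^ (-γ) := mul_le_mul_of_nonneg_right (le_abs_self C) (by positivity)
          _ ≤ _ := mul_le_mul_of_nonneg_left h5 (abs_nonneg _)
      rw [zero_add, mul_assoc, add_mul]
      have n1 := mul_nonneg (abs_nonneg C1) hP
      have n2 := mul_nonneg (abs_nonneg C2) hP
      rcases le_total 0 x with h0 | h0
      · rw [abs_of_nonneg h0] at hx
        have := hl' (show x ∈ Ioo l b from ⟨by linarith, b2⟩)
        refine ⟨this.1, ?_⟩
        have := gen (b - x) C1 (by linarith) (inv_dist_le hxb).1 this.2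
        linarith
      · rw [abs_of_nonpos h0] at hx
        have := hr' (show x ∈ Ioo (-b) r from ⟨b1, by linarith⟩)
        refine ⟨this.1, ?_⟩
        have := gen (b + x) C2 (by linarith) (inv_dist_le hxb).2 this.2
        linarith
    refine ⟨hc, ?_, γ, 0, _, ρ, hρb, fun x hx hxb => (hside x hx hxb).2⟩
    have hsub : Icc (-ρ) ρ ⊆ Ioo (-b) b := fun x hx => ⟨by linarith [hx.1], by linarith [hx.2]⟩
    obtain ⟨m, hm⟩ := isCompact_Icc.bddBelow_image (hc.mono hsub)
    refine ⟨max 0 (-m), fun x hx => ?_⟩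
    rcases le_total ρ |x| with h | h
    · have := (hside x h (abs_lt.2 hx)).1
      have := le_max_left 0 (-m)
      linarith
    · have := hm (mem_image_of_mem _ (abs_le.1 h))
      have := le_max_right 0 (-m)
      linarith

/-- the super-barrier -/
def WW (b c0 G M y η : ℝ) (k : ℕ) (p : ℝ × ℝ) : ℝ :=
  c0 + G * p.2 + M * (p.1 - y) ^ 2 + η * (1 + p.2) * ((b ^ 2 - p.1 ^ 2)⁻¹) ^ (k + 1)

theorem phi_pow_deriv {b x : ℝ} (hq : b ^ 2 - x ^ 2 ≠ 0) (n : ℕ) :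
    HasDerivAt (fun x => ((b ^ 2 - x ^ 2)⁻¹) ^ (n + 1))
      (2 * (n + 1) * x * ((b ^ 2 - x ^ 2)⁻¹) ^ (n + 2)) x := by
  have h1 : HasDerivAt (fun x : ℝ => b ^ 2 - x ^ 2) (-(2 * x)) x := by
    simpa using (hasDerivAt_pow 2 x).const_sub (b ^ 2)
  have h2 := (h1.inv hq).pow (n + 1)
  refine h2.congr_deriv ?_
  simp only [Nat.add_sub_cancel]
  push_cast
  simp only [Pi.inv_apply]
  rw [neg_neg, div_eq_mul_inv, ← inv_pow]
  ring

theorem WW_derivs {b c0 G M y η : ℝ} {k : ℕ} {p : ℝ × ℝ} (hp : p ∈ Qset b) :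
    pX (WW b c0 G M y η k) p = dW b M y η k p ∧ pXX (WW b c0 G M y η k) p = ddW b M η k p ∧
    pT (WW b c0 G M y η k) p = G + η * ((b ^ 2 - p.1 ^ 2)⁻¹) ^ (k + 1) := by
  have hD : ∀ x : ℝ, |x| < b → HasDerivAt (fun x => WW b c0 G M y η k (x, p.2))
      (dW b M y η k (x, p.2)) x := by
    intro x hx
    have h1 := phi_pow_deriv (q_pos hx).ne' k
    have h2 : HasDerivAt (fun x : ℝ => M * (x - y) ^ 2) (2 * M * (x - y)) x := by
      have := (((hasDerivAt_id x).sub_const y).pow 2).const_mul M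
      refine this.congr_deriv ?_
      simp; ring
    have h3 := (h2.const_add (c0 + G * p.2)).add (h1.const_mul (η * (1 + p.2)))
    exact h3
  have hD2 : ∀ x : ℝ, |x| < b → HasDerivAt (fun x => dW b M y η k (x, p.2))
      (ddW b M η k (x, p.2)) x := by
    intro x hx
    have h1 := phi_pow_deriv (q_pos hx).ne' (k + 1)
    have h2 : HasDerivAt (fun x : ℝ => 2 * M * (x - y)) (2 * M) x := by
      simpa using ((hasDerivAt_id x).sub_const y).const_mul (2 * M)
    have h4 : HasDerivAt (fun x : ℝ => 2 * ((k:ℝ) + 1) * x) (2 * ((k:ℝ) + 1)) x := by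
      simpa using (hasDerivAt_id x).const_mul (2 * ((k:ℝ) + 1))
    have h3 := h2.add ((h4.mul h1).const_mul (η * (1 + p.2)))
    refine h3.congr_deriv ?_
    simp only [ddW]
    push_cast
    ring
  have hpx : |p.1| < b := abs_lt.2 hp.1
  have hev : ∀ᶠ x in 𝓝 p.1, |x| < b := (continuous_abs.tendsto p.1).eventually_lt_const hpx
  obtain ⟨a1, a2⟩ := pX_pXX_of (φ := WW b c0 G M y η k) (p := p) (hev.mono hD) (hD2 p.1 hpx)
  refine ⟨a1, a2, ?_⟩
  have h1 : HasDerivAt (fun t : ℝ => c0 + G * t + M * (p.1 - y) ^ 2 +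
      η * (1 + t) * ((b ^ 2 - p.1 ^ 2)⁻¹) ^ (k + 1))
      (G + η * ((b ^ 2 - p.1 ^ 2)⁻¹) ^ (k + 1)) p.2 := by
    have e1 : HasDerivAt (fun t : ℝ => c0 + G * t + M * (p.1 - y) ^ 2) G p.2 := by
      simpa using (((hasDerivAt_id p.2).const_mul G).const_add c0).add_const (M * (p.1 - y) ^ 2)
    have e2 : HasDerivAt (fun t : ℝ => η * (1 + t) * ((b ^ 2 - p.1 ^ 2)⁻¹) ^ (k + 1))
        (η * ((b ^ 2 - p.1 ^ 2)⁻¹) ^ (k + 1)) p.2 := by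
      simpa using ((((hasDerivAt_id p.2).const_add 1).const_mul η).mul_const
        (((b ^ 2 - p.1 ^ 2)⁻¹) ^ (k + 1)))
    exact e1.add e2
  exact h1.deriv

theorem super_exists {b α β : ℝ} {f g u0 : ℝ → ℝ} (hb : 0 < b) (hf : A1 f) (hf3 : A3 f β)
    (hg : A2 g α) (k : ℕ) (he : β * ((k + 3) - α * (k + 2)) < k + 1)
    (hu : ContinuousOn u0 (Ioo (-b) b)) {γ C C' ρ : ℝ} (hγ : γ < k + 1) (hρ : ρ < b)
    (hlat : ∀ x, ρ ≤ |x| → |x| < b → u0 x ≤ C + C' * ((b ^ 2 - x ^ 2)⁻¹) ^ γ)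
    {y ε T : ℝ} (hy : y ∈ Ioo (-b) b) (hε : 0 < ε) (hT : 0 ≤ T) :
    ∃ W : ℝ × ℝ → ℝ, ContinuousOn W (Q0set b) ∧ ContDiffOn ℝ 2 W (Qset b) ∧
      (∀ p ∈ Qset b, p.2 ≤ T → 0 < EOp f g W p) ∧ (∀ x ∈ Ioo (-b) b, u0 x ≤ W (x, 0)) ∧
      W (y, 0) ≤ u0 y + ε ∧
      ∃ B η : ℝ, 0 < η ∧ ∀ x t, |x| < b → 0 ≤ t →
        -B + η * ((b ^ 2 - x ^ 2)⁻¹) ^ (k + 1) ≤ W (x, t) := by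
  have hqy := q_pos (abs_lt.2 hy)
  set η : ℝ := ε / 2 / ((b ^ 2 - y ^ 2)⁻¹) ^ (k + 1) with hη
  have hηp : 0 < η := by positivity
  obtain ⟨δ, hδ, hδ'⟩ := Metric.continuousWithinAt_iff.1 (hu y hy) (ε / 2) (by positivity)
  obtain ⟨R, hR, hdom⟩ := pow_dom γ k hγ (C - u0 y) C' η hηp
  obtain ⟨ρ', hρ', -, hlp⟩ := lat_phi hb R (by linarith)
  set r := max ρ ρ' with hr
  have hrb : r < b := max_lt hρ hρ'
  have hsub : Icc (-r) r ⊆ Ioo (-b) b := fun x hx => ⟨by linarith [hx.1], by linarith [hx.2]⟩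
  obtain ⟨K, hK⟩ := isCompact_Icc.bddAbove_image (hu.mono hsub)
  set M := max 0 ((K - u0 y) / δ ^ 2) with hM
  have hM0 : 0 ≤ M := le_max_left _ _
  have hM1 : K - u0 y ≤ M * δ ^ 2 := by
    rw [← div_le_iff₀ (by positivity)]; exact le_max_right _ _
  obtain ⟨G, hG, hGs⟩ := super_bound hb hf hf3 hg k he hM0 hηp hT hy
  have hne : ∀ p ∈ Q0set b, b ^ 2 - p.1 ^ 2 ≠ 0 := fun p hp => (q_pos (abs_lt.2 hp.1)).ne'
  refine ⟨WW b (u0 y + ε / 2) G M y η k, ?_, ?_, ?_, ?_, ?_, -(u0 y), η, hηp, ?_⟩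
  · have c0 : ContinuousOn (fun p : ℝ × ℝ => (b ^ 2 - p.1 ^ 2)⁻¹) (Q0set b) :=
      ContinuousOn.inv₀ (by fun_prop) hne
    unfold WW; fun_prop
  · have c0 : ContDiffOn ℝ 2 (fun p : ℝ × ℝ => (b ^ 2 - p.1 ^ 2)⁻¹) (Qset b) :=
      ContDiffOn.inv (by fun_prop) (fun p hp => hne p (Qset_sub_Q0 b hp))
    unfold WW; fun_prop
  · intro p hp hpT
    obtain ⟨e1, e2, e3⟩ := WW_derivs (c0 := u0 y + ε / 2) (G := G) (M := M) (y := y) (η := η)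
      (k := k) hp
    unfold EOp
    rw [e1, e2, e3]
    have := hGs p.1 p.2 (abs_lt.2 hp.1) (le_of_lt hp.2) hpT
    exact sub_pos.2 this
  · intro x hx
    have hxa := abs_lt.2 hx
    have hq := q_pos hxa
    have hΦ : 0 < η * ((b ^ 2 - x ^ 2)⁻¹) ^ (k + 1) := by positivity
    have hMq : 0 ≤ M * (x - y) ^ 2 := by positivity
    simp only [WW, mul_zero, add_zero, mul_one]
    rcases lt_or_ge |x - y| δ with h | h
    · have := hδ' hx (by rwa [Real.dist_eq])
      rw [Real.dist_eq] at this
      have := (abs_lt.1 this).2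
      linarith
    · rcases le_total r |x| with h' | h'
      · have l1 := hlat x ((le_max_left _ _).trans h') hxa
        have l2 := hdom _ (hlp x ((le_max_right _ _).trans h') hxa)
        linarith
      · have l1 := hK (mem_image_of_mem _ (abs_le.1 h'))
        have l2 : δ ^ 2 ≤ (x - y) ^ 2 := by
          rw [← sq_abs (x - y)]; exact pow_le_pow_left₀ hδ.le h 2
        have l3 := mul_le_mul_of_nonneg_left l2 hM0
        linarith
  · simp only [WW, mul_zero, add_zero, mul_one, sub_self]
    rw [hη, div_mul_cancel₀ _ (by positivity)]
    norm_num
    linarith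
  · intro x t hx ht
    have hq := q_pos hx
    simp only [WW]
    have h1 : 0 ≤ G * t := by positivity
    have h2 : 0 ≤ M * (x - y) ^ 2 := by positivity
    have h3 : 0 ≤ η * t * ((b ^ 2 - x ^ 2)⁻¹) ^ (k + 1) := by positivity
    nlinarith

/-- admissible continuous sub-barriers -/
def GoodV (b : ℝ) (f g u0 : ℝ → ℝ) (κ : ℝ) (V : ℝ × ℝ → ℝ) : Prop :=
  ContinuousOn V (Q0set b) ∧ (∀ p ∈ Qset b, SubAt b f g V p) ∧
  (∀ x ∈ Ioo (-b) b, V (x, 0) ≤ u0 x) ∧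
  ∀ T : ℝ, ∃ C C' : ℝ, ∀ x t, |x| < b → 0 ≤ t → t < T → V (x, t) ≤ C + C' * ((b ^ 2 - x ^ 2)⁻¹) ^ κ

theorem sub1_exists {b κ : ℝ} {f g u0 : ℝ → ℝ} (hb : 0 < b) (hfc : Continuous f)
    (hfm : StrictMono f) (hgc : Continuous g) (hgp : ∀ s, 0 < g s)
    (hu : ContinuousOn u0 (Ioo (-b) b)) {m : ℝ} (hm : ∀ x ∈ Ioo (-b) b, -m ≤ u0 x)
    {y ε : ℝ} (hy : y ∈ Ioo (-b) b) (hε : 0 < ε) :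
    ∃ V, GoodV b f g u0 κ V ∧ u0 y - ε ≤ V (y, 0) := by
  obtain ⟨δ, hδ, hδ'⟩ := Metric.continuousWithinAt_iff.1 (hu y hy) ε hε
  set M := max 0 ((u0 y + m) / δ ^ 2) with hM
  have hM0 : 0 ≤ M := le_max_left _ _
  have hM1 : u0 y + m ≤ M * δ ^ 2 := by
    rw [← div_le_iff₀ (by positivity)]; exact le_max_right _ _
  have cc : ContinuousOn (fun p => f (g p * (-(2 * M)))) (Icc (-(4 * M * b)) (4 * M * b)) := by
    fun_prop
  obtain ⟨K, hK⟩ := isCompact_Icc.bddBelow_image cc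
  set C := max 0 (-K) with hC
  have hC0 : 0 ≤ C := le_max_left _ _
  have hC1 : -K ≤ C := le_max_right _ _
  set V : ℝ × ℝ → ℝ := fun p => u0 y - ε - M * (p.1 - y) ^ 2 - C * p.2 with hV
  refine ⟨V, ⟨?_, ?_, ?_, ?_⟩, ?_⟩
  · rw [hV]; fun_prop
  · intro p hp
    refine SubAt.classical hfm hgp (by rw [hV]; fun_prop) hp ?_
    have h1 : ∀ x : ℝ, HasDerivAt (fun x => V (x, p.2)) (-(2 * M * (x - y))) x := by
      intro x
      have h2 : HasDerivAt (fun x : ℝ => M * (x - y) ^ 2) (2 * M * (x - y)) x := by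
        have := (((hasDerivAt_id x).sub_const y).pow 2).const_mul M
        refine this.congr_deriv ?_
        simp; ring
      exact (h2.const_sub (u0 y - ε)).sub_const (C * p.2)
    have h2 : HasDerivAt (fun x : ℝ => -(2 * M * (x - y))) (-(2 * M)) p.1 := by
      have h3 := (((hasDerivAt_id p.1).sub_const y).const_mul (2 * M)).neg
      rw [mul_one] at h3
      exact h3
    obtain ⟨a1, a2⟩ := pX_pXX_of (φ := V) (p := p) (Eventually.of_forall h1) h2
    have a3 : pT V p = -C := by
      have : HasDerivAt (fun t : ℝ => u0 y - ε - M * (p.1 - y) ^ 2 - C * t) (-C) p.2 := by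
        simpa using ((hasDerivAt_id p.2).const_mul C).const_sub (u0 y - ε - M * (p.1 - y) ^ 2)
      exact this.deriv
    unfold EOp
    rw [a1, a2, a3]
    have hxy : |p.1 - y| ≤ 2 * b := by
      have h3 := abs_lt.2 hy
      have h4 := abs_lt.2 hp.1
      calc |p.1 - y| ≤ |p.1| + |y| := abs_sub _ _
        _ ≤ 2 * b := by linarith
    have hab : |-(2 * M * (p.1 - y))| ≤ 4 * M * b := by
      rw [abs_neg, abs_mul, abs_of_nonneg (by positivity)]
      calc 2 * M * |p.1 - y| ≤ 2 * M * (2 * b) := mul_le_mul_of_nonneg_left hxy (by positivity)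
        _ = _ := by ring
    have := hK (mem_image_of_mem _ (abs_le.1 hab))
    linarith
  · intro x hx
    have hMq : 0 ≤ M * (x - y) ^ 2 := by positivity
    simp only [hV, mul_zero, sub_zero]
    rcases lt_or_ge |x - y| δ with h | h
    · have := hδ' hx (by rwa [Real.dist_eq])
      rw [Real.dist_eq] at this
      have := (abs_lt.1 this).1
      linarith
    · have l2 : δ ^ 2 ≤ (x - y) ^ 2 := by
        rw [← sq_abs (x - y)]; exact pow_le_pow_left₀ hδ.le h 2
      have l3 := mul_le_mul_of_nonneg_left l2 hM0
      have := hm x hx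
      linarith
  · intro T
    refine ⟨u0 y, 0, fun x t _ ht _ => ?_⟩
    have hMq : 0 ≤ M * (x - y) ^ 2 := by positivity
    have : 0 ≤ C * t := by positivity
    simp only [hV]
    linarith
  · simp [hV]

theorem sub2_key {α β θ σ κ cg cf c t d D : ℝ} (hθ : θ = β * (1 - α))
    (hκ0 : 0 < κ) (hcg : 0 < cg) (hc : 0 < c) (ht : 0 < t) (hd : 0 < d)
    (hσθ : σ * θ = σ - 1) (hκ : (κ + 1) * θ + β = κ) (hD : D = cf * (cg * (κ + 1)) ^ β)
    (hcE : c * σ = D * κ ^ θ * c ^ θ) :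
    cf * (cg * (κ + 1) * (c * κ * t ^ σ * d ^ (-κ - 1)) ^ (1 - α) / d) ^ β =
      c * σ * t ^ (σ - 1) * d ^ (-κ) := by
  set P := c * κ * t ^ σ * d ^ (-κ - 1) with hP
  have hPp : 0 < P := by positivity
  have e1 : (P ^ (1 - α)) ^ β = P ^ θ := by rw [← Real.rpow_mul hPp.le, hθ, mul_comm]
  have e2 : P ^ θ = c ^ θ * κ ^ θ * t ^ (σ - 1) * d ^ ((-κ - 1) * θ) := by
    rw [hP, Real.mul_rpow (by positivity) (by positivity),
      Real.mul_rpow (by positivity) (by positivity), Real.mul_rpow hc.le hκ0.le,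
      ← Real.rpow_mul ht.le, ← Real.rpow_mul hd.le, hσθ]
  have e3 : d ^ ((-κ - 1) * θ) / d ^ β = d ^ (-κ) := by
    rw [← Real.rpow_sub hd]; congr 1; linarith
  rw [Real.div_rpow (by positivity) hd.le, Real.mul_rpow (by positivity) (by positivity), e1, e2,
    hcE, hD, ← e3]
  ring

/-- the blow-up piece of the sub-barrier -/
def SS (b c σ κ ς a : ℝ) (p : ℝ × ℝ) : ℝ := c * p.2 ^ σ * (b - ς * p.1) ^ (-κ) - a

theorem SS_derivs {b c σ κ ς a : ℝ} (hς : ς = 1 ∨ ς = -1) {p : ℝ × ℝ} (hp : p ∈ Qset b) :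
    pX (SS b c σ κ ς a) p = ς * (c * κ * p.2 ^ σ * (b - ς * p.1) ^ (-κ - 1)) ∧
    pXX (SS b c σ κ ς a) p =
      (κ + 1) * (c * κ * p.2 ^ σ * (b - ς * p.1) ^ (-κ - 1)) / (b - ς * p.1) ∧
    pT (SS b c σ κ ς a) p = c * σ * p.2 ^ (σ - 1) * (b - ς * p.1) ^ (-κ) := by
  have hdpos : ∀ x : ℝ, |x| < b → 0 < b - ς * x := by
    intro x hx
    obtain ⟨h1, h2⟩ := abs_lt.1 hx
    rcases hς with rfl | rfl <;> linarith
  have hς2 : ς * ς = 1 := by rcases hς with rfl | rfl <;> norm_num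
  have hd : ∀ x : ℝ, HasDerivAt (fun x : ℝ => b - ς * x) (-ς) x := by
    intro x
    simpa using ((hasDerivAt_id x).const_mul ς).const_sub b
  have hD : ∀ x : ℝ, |x| < b → HasDerivAt (fun x => SS b c σ κ ς a (x, p.2))
      (ς * (c * κ * p.2 ^ σ * (b - ς * x) ^ (-κ - 1))) x := by
    intro x hx
    have h1 := (((hd x).rpow_const (p := -κ) (Or.inl (hdpos x hx).ne')).const_mul
      (c * p.2 ^ σ)).sub_const a
    refine h1.congr_deriv ?_
    ring
  have hpx : |p.1| < b := abs_lt.2 hp.1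
  have hD2 : HasDerivAt (fun x => ς * (c * κ * p.2 ^ σ * (b - ς * x) ^ (-κ - 1)))
      ((κ + 1) * (c * κ * p.2 ^ σ * (b - ς * p.1) ^ (-κ - 1)) / (b - ς * p.1)) p.1 := by
    have h1 := (((hd p.1).rpow_const (p := -κ - 1) (Or.inl (hdpos p.1 hpx).ne')).const_mul
      (c * κ * p.2 ^ σ)).const_mul ς
    refine h1.congr_deriv ?_
    rw [Real.rpow_sub_one (hdpos p.1 hpx).ne' (-κ - 1)]
    linear_combination (c * κ * p.2 ^ σ * (κ + 1) * ((b - ς * p.1) ^ (-κ - 1) / (b - ς * p.1))) * hς2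
  have hev : ∀ᶠ x in 𝓝 p.1, |x| < b := (continuous_abs.tendsto p.1).eventually_lt_const hpx
  obtain ⟨a1, a2⟩ := pX_pXX_of (φ := SS b c σ κ ς a) (p := p) (hev.mono hD) hD2
  refine ⟨a1, a2, ?_⟩
  have ht : (0:ℝ) < p.2 := hp.2
  have h1 : HasDerivAt (fun t : ℝ => c * t ^ σ * (b - ς * p.1) ^ (-κ) - a)
      (c * σ * p.2 ^ (σ - 1) * (b - ς * p.1) ^ (-κ)) p.2 := by
    have := (((Real.hasDerivAt_rpow_const (p := σ) (Or.inl ht.ne')).const_mul c).mul_const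
      ((b - ς * p.1) ^ (-κ))).sub_const a
    refine this.congr_deriv ?_
    ring
  exact h1.deriv

theorem sub2_exists {b α β θ σ κ : ℝ} {f g u0 : ℝ → ℝ} (hb : 0 < b) (hf : A1 f) (hf3 : A3 f β)
    (hg : A2 g α) (hα : α ≤ 1) (hθ : θ = β * (1 - α)) (hκ0 : 0 < κ) (hσ1 : 1 ≤ σ)
    (hσθ : σ * θ = σ - 1) (hκ : (κ + 1) * θ + β = κ)
    {m : ℝ} (hm : ∀ x ∈ Ioo (-b) b, -m ≤ u0 x) {ς : ℝ} (hς : ς = 1 ∨ ς = -1) :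
    ∃ V, GoodV b f g u0 κ V ∧ ∃ c a : ℝ, 0 < c ∧
      ∀ x t, c * t ^ σ * (b - ς * x) ^ (-κ) - a ≤ V (x, t) := by
  obtain ⟨cg, Cg, Rg, hcg, hCg, hRg, hgb⟩ := g_bounds hg
  set s1 : ℝ := cg * (κ + 1) / (2 * b) with hs1
  obtain ⟨cf, hcf, hfl⟩ := f_lower hf hf3 (s1 := s1) (by positivity)
  set D := cf * (cg * (κ + 1)) ^ β with hD
  have hDp : 0 < D := by positivity
  set E := D * κ ^ θ / σ with hE
  have hσ0 : 0 < σ := by linarith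
  have hEp : 0 < E := by positivity
  set c := E ^ σ with hc
  have hcp : 0 < c := by positivity
  have hcE : c * σ = D * κ ^ θ * c ^ θ := by
    have h1 : c ^ θ = E ^ (σ - 1) := by rw [hc, ← Real.rpow_mul hEp.le, hσθ]
    have h2 : c = E * E ^ (σ - 1) := by
      rw [hc, Real.rpow_sub_one hEp.ne']; field_simp
    rw [h1]
    calc c * σ = E * σ * E ^ (σ - 1) := by rw [h2]; ring
      _ = _ := by rw [hE, div_mul_cancel₀ _ hσ0.ne']
  set A := Rg * (2 * b) / κ with hA
  have hAp : 0 < A := by positivity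
  have hdpos : ∀ x : ℝ, |x| < b → 0 < b - ς * x ∧ b - ς * x ≤ 2 * b ∧
      (b - ς * x)⁻¹ ≤ 2 * b * (b ^ 2 - x ^ 2)⁻¹ := by
    intro x hx
    obtain ⟨h1, h2⟩ := abs_lt.1 hx
    obtain ⟨h3, h4⟩ := inv_dist_le hx
    rcases hς with rfl | rfl
    · rw [one_mul]; exact ⟨by linarith, by linarith, h3⟩
    · rw [neg_one_mul, sub_neg_eq_add]; exact ⟨by linarith, by linarith, h4⟩
  have hς1 : |ς| = 1 := by rcases hς with rfl | rfl <;> simp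
  set S := SS b c σ κ ς (A + m) with hS
  have hScont : ContinuousOn S (Q0set b) := by
    have c1 : ContinuousOn (fun p : ℝ × ℝ => p.2 ^ σ) (Q0set b) :=
      ContinuousOn.rpow_const (by fun_prop) (fun p _ => Or.inr hσ0.le)
    have c2 : ContinuousOn (fun p : ℝ × ℝ => (b - ς * p.1) ^ (-κ)) (Q0set b) :=
      ContinuousOn.rpow_const (by fun_prop) (fun p hp => Or.inl (hdpos p.1 (abs_lt.2 hp.1)).1.ne')
    rw [hS]; unfold SS; fun_prop
  have hSd : ContDiffOn ℝ 2 S (Qset b) := by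
    have c1 : ContDiffOn ℝ 2 (fun p : ℝ × ℝ => p.2 ^ σ) (Qset b) :=
      ContDiffOn.rpow_const_of_ne (by fun_prop) (fun p hp => ne_of_gt hp.2)
    have c2 : ContDiffOn ℝ 2 (fun p : ℝ × ℝ => (b - ς * p.1) ^ (-κ)) (Qset b) :=
      ContDiffOn.rpow_const_of_ne (by fun_prop) (fun p hp => (hdpos p.1 (abs_lt.2 hp.1)).1.ne')
    rw [hS]; unfold SS; fun_prop
  have hSsub : ∀ p ∈ Qset b, -m ≤ S p → EOp f g S p ≤ 0 := by
    intro p hp hSp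
    obtain ⟨e1, e2, e3⟩ := SS_derivs (c := c) (σ := σ) (κ := κ) (a := A + m) hς hp
    unfold EOp
    rw [hS, e1, e2, e3]
    obtain ⟨d0, d1, -⟩ := hdpos p.1 (abs_lt.2 hp.1)
    have ht : 0 < p.2 := hp.2
    set d := b - ς * p.1 with hd
    set P := c * κ * p.2 ^ σ * d ^ (-κ - 1) with hP
    have hPp : 0 < P := by positivity
    have hSA : A ≤ c * p.2 ^ σ * d ^ (-κ) := by
      have : S p = c * p.2 ^ σ * d ^ (-κ) - (A + m) := rfl
      linarith
    have hPd : P = κ * (c * p.2 ^ σ * d ^ (-κ)) / d := by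
      rw [hP, Real.rpow_sub_one d0.ne']; ring
    have hPR : Rg ≤ P := by
      rw [hPd, le_div_iff₀ d0]
      calc Rg * d ≤ Rg * (2 * b) := by gcongr
        _ = κ * A := by rw [hA]; field_simp
        _ ≤ _ := by gcongr
    have habs : |ς * P| = P := by rw [abs_mul, hς1, one_mul, abs_of_pos hPp]
    have hgl := (hgb (ς * P) (by rw [habs]; exact hPR)).1
    rw [habs] at hgl
    set s' := cg * (κ + 1) * P ^ (1 - α) / d with hs'
    have hss : s' ≤ g (ς * P) * ((κ + 1) * P / d) := by
      calc s' = cg * P ^ (-α) * ((κ + 1) * P / d) := by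
            rw [hs', show (1 - α) = -α + 1 by ring, Real.rpow_add_one hPp.ne']; ring
        _ ≤ _ := by gcongr
    have hs1' : s1 ≤ s' := by
      have h1 : 1 ≤ P ^ (1 - α) := Real.one_le_rpow (hRg.trans hPR) (by linarith)
      calc s1 = cg * (κ + 1) * 1 / (2 * b) := by rw [hs1, mul_one]
        _ ≤ s' := by rw [hs']; gcongr
    have h1 := hfl s' hs1'
    have h2 := hf.2.1.monotone hss
    have h3 := sub2_key hθ hκ0 hcg hcp ht d0 hσθ hκ hD hcE
    rw [← hP, ← hs'] at h3
    linarith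
  refine ⟨fun p => max (-m) (S p), ⟨?_, ?_, ?_, ?_⟩, c, A + m, hcp, fun x t => le_max_right _ _⟩
  · exact continuousOn_const.sup hScont
  · intro p hp
    rcases le_total (S p) (-m) with h | h
    · refine SubAt.of_touch (w' := fun _ => -m) ?_ (Eventually.of_forall fun q => le_max_left _ _)
        (max_eq_left h).symm
      refine SubAt.classical hf.2.1 hg.2.1 contDiffOn_const hp ?_
      simp [EOp, pT, pX, pXX, hf.2.2.1]
    · refine SubAt.of_touch (w' := S) ?_ (Eventually.of_forall fun q => le_max_right _ _)
        (max_eq_right h).symm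
      exact SubAt.classical hf.2.1 hg.2.1 hSd hp (hSsub p hp h)
  · intro x hx
    have : S (x, 0) = - (A + m) := by
      rw [hS]; simp [SS, Real.zero_rpow hσ0.ne']
    refine (max_le (hm x hx) ?_ : max (-m) (S (x, 0)) ≤ u0 x)
    rw [this]
    have := hm x hx
    linarith
  · intro T
    refine ⟨|m|, c * |T| ^ σ * (2 * b) ^ κ, fun x t hx h0 hT => ?_⟩
    have hq := q_pos hx
    obtain ⟨d0, d1, d2⟩ := hdpos x hx
    have hm1 := neg_le_abs m
    have hP : 0 ≤ c * |T| ^ σ * (2 * b) ^ κ * ((b ^ 2 - x ^ 2)⁻¹) ^ κ := by positivity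
    refine max_le (by linarith) ?_
    have h1 := dist_rpow_le hx hκ0.le d0 d2
    have h2 : c * t ^ σ * (b - ς * x) ^ (-κ) ≤
        c * |T| ^ σ * ((2 * b) ^ κ * ((b ^ 2 - x ^ 2)⁻¹) ^ κ) := by
      have : t ≤ |T| := hT.le.trans (le_abs_self T)
      gcongr
    have h3 : S (x, t) = c * t ^ σ * (b - ς * x) ^ (-κ) - (A + m) := rfl
    rw [h3, mul_assoc (c * |T| ^ σ)]
    linarith

theorem blow_up {b c σ κ a ς : ℝ} {l : Filter ℝ} (hc : 0 < c) (hκ : 0 < κ) {V : ℝ × ℝ → ℝ}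
    (hV : ∀ x t, c * t ^ σ * (b - ς * x) ^ (-κ) - a ≤ V (x, t))
    (hl : Tendsto (fun x => b - ς * x) l (𝓝[>] 0)) {t : ℝ} (ht : 0 < t) :
    Tendsto (fun x => V (x, t)) l atTop := by
  have h1 : Tendsto (fun x => (b - ς * x) ^ (-κ)) l atTop :=
    (tendsto_rpow_neg_nhdsGT_zero (neg_lt_zero.2 hκ)).comp hl
  have h2 : 0 < c * t ^ σ := by positivity
  exact tendsto_atTop_mono (fun x => hV x t)
    (tendsto_atTop_add_const_right _ (-a) (h1.const_mul_atTop h2))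

theorem exists_main (b α β : ℝ) (f g u0 : ℝ → ℝ)
    (hb : 0 < b) (hf : A1 f) (hf3 : A3 f β) (hg : A2 g α)
    (hcase : α = 1 ∨ (α < 1 ∧ β < 1 / (1 - α)))
    (hu0 : B1 b u0 ∨ B2 b u0) :
    ∃ u : ℝ × ℝ → ℝ, IsVSol b f g u0 u := by
  obtain ⟨huc, ⟨m, hm⟩, γ, C, C', ρ, hρ, hlat⟩ := u0_facts hb hu0
  have hβ : 0 < β := hf3.1
  have hα : α ≤ 1 := by rcases hcase with h | h <;> linarith [h]
  set θ := β * (1 - α) with hθ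
  have hθ0 : 0 ≤ θ := mul_nonneg hβ.le (by linarith)
  have hθ1 : θ < 1 := by
    rcases hcase with h | ⟨h, h'⟩
    · rw [hθ, h]; norm_num
    · rwa [lt_div_iff₀ (by linarith)] at h'
  have h1θ : 0 < 1 - θ := by linarith
  set σ := 1 / (1 - θ) with hσ
  have hσ1 : 1 ≤ σ := by rw [hσ, le_div_iff₀ h1θ]; linarith
  have hσθ : σ * θ = σ - 1 := by rw [hσ]; field_simp; ring
  set κ := (θ + β) / (1 - θ) with hκd
  have hκ0 : 0 < κ := by positivity
  have hκ : (κ + 1) * θ + β = κ := by rw [hκd]; field_simp; ring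
  obtain ⟨k, hk⟩ := exists_nat_gt (max γ κ)
  have hkγ : γ < k + 1 := by have := le_max_left γ κ; linarith
  have hkκ : κ < k + 1 := by have := le_max_right γ κ; linarith
  have he : β * ((k + 3) - α * (k + 2)) < k + 1 := by
    have h1 : θ + β < (k + 1) * (1 - θ) := by rwa [hκd, div_lt_iff₀ h1θ] at hkκ
    have h2 : β * ((k + 3) - α * (k + 2)) = (k + 2) * θ + β := by rw [hθ]; ring
    rw [h2]; linarith
  let ι := {P : (ℝ × ℝ → ℝ) × ℝ // ContinuousOn P.1 (Q0set b) ∧ ContDiffOn ℝ 2 P.1 (Qset b) ∧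
      (∀ p ∈ Qset b, p.2 ≤ P.2 → 0 < EOp f g P.1 p) ∧ (∀ x ∈ Ioo (-b) b, u0 x ≤ P.1 (x, 0)) ∧
      ∃ B η : ℝ, 0 < η ∧ ∀ x t, |x| < b → 0 ≤ t →
        -B + η * ((b ^ 2 - x ^ 2)⁻¹) ^ (k + 1) ≤ P.1 (x, t)}
  let J := {V : ℝ × ℝ → ℝ // GoodV b f g u0 κ V}
  refine perron (ι := ι) (κ := J) hf.1 hg.1 hf.2.1 hg.2.1 (fun i => i.1.1) (fun i => i.1.2)
    (fun j => j.1) (fun i => i.2.1) (fun i => i.2.2.1) (fun i => i.2.2.2.1) (fun i => i.2.2.2.2.1)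
    ?_ (fun j => j.2.1) (fun j => j.2.2.1) (fun j => j.2.2.2.1) ?_ ?_ ?_ ?_ hb
  · intro y hy ε hε t
    obtain ⟨W, w1, w2, w3, w4, w5, w6⟩ := super_exists hb hf hf3 hg k he huc hkγ hρ hlat hy hε
      (T := |t| + 1) (by positivity)
    exact ⟨⟨(W, |t| + 1), w1, w2, w3, w4, w6⟩, by have := le_abs_self t; simp only; linarith, w5⟩
  · intro y hy ε hε
    obtain ⟨V, h1, h2⟩ := sub1_exists (κ := κ) hb hf.1 hf.2.1 hg.1 hg.2.1 huc hm hy hε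
    exact ⟨⟨V, h1⟩, h2⟩
  · intro j i
    obtain ⟨B, η, hη, hW⟩ := i.2.2.2.2.2
    obtain ⟨D, D', hV⟩ := j.2.2.2.2 i.1.2
    obtain ⟨R, hR, hdom⟩ := pow_dom κ k hkκ (D + B) D' η hη
    obtain ⟨r, hr, -, hlp⟩ := lat_phi hb R (by linarith)
    refine ⟨r, hr, fun x t h1 h2 h3 h4 => ?_⟩
    have a1 := hW x t h2 h3
    have a2 := hV x t h2 h3 h4
    have a3 := hdom _ (hlp x h1 h2)
    linarith
  · obtain ⟨V, h1, c, a, hc, h2⟩ := sub2_exists hb hf hf3 hg hα hθ hκ0 hσ1 hσθ hκ hm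
      (ς := 1) (Or.inl rfl)
    refine ⟨⟨V, h1⟩, fun t ht => blow_up hc hκ0 h2 ?_ ht⟩
    refine tendsto_nhdsWithin_iff.2 ⟨?_, ?_⟩
    · have : Tendsto (fun x : ℝ => b - 1 * x) (𝓝 b) (𝓝 (b - 1 * b)) :=
        Continuous.tendsto (by fun_prop) b
      simp only [one_mul, sub_self] at this ⊢
      exact this.mono_left nhdsWithin_le_nhds
    · filter_upwards [self_mem_nhdsWithin] with x hx
      simp only [mem_Iio, mem_Ioi] at hx ⊢
      linarith
  · obtain ⟨V, h1, c, a, hc, h2⟩ := sub2_exists hb hf hf3 hg hα hθ hκ0 hσ1 hσθ hκ hm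
      (ς := -1) (Or.inr rfl)
    refine ⟨⟨V, h1⟩, fun t ht => blow_up hc hκ0 h2 ?_ ht⟩
    refine tendsto_nhdsWithin_iff.2 ⟨?_, ?_⟩
    · have : Tendsto (fun x : ℝ => b - -1 * x) (𝓝 (-b)) (𝓝 (b - -1 * -b)) :=
        Continuous.tendsto (by fun_prop) (-b)
      rw [show b - -1 * -b = 0 by ring] at this
      exact this.mono_left nhdsWithin_le_nhds
    · filter_upwards [self_mem_nhdsWithin] with x hx
      simp only [mem_Ioi] at hx ⊢
      linarith

/-- existence for `α = 1`, or `α < 1` and `β < 1/(1-α)`, under (B1) or (B2). -/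
theorem existence_small_alpha (b α β : ℝ) (f g u0 : ℝ → ℝ)
    (hb : 0 < b) (hf : A1 f) (hf3 : A3 f β) (hg : A2 g α)
    (hcase : α = 1 ∨ (α < 1 ∧ β < 1 / (1 - α)))
    (hu0 : B1 b u0 ∨ B2 b u0) :
    ∃ u : ℝ × ℝ → ℝ, IsVSol b f g u0 u := by
  exact exists_main b α β f g u0 hb hf hf3 hg hcase hu0
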